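/- Let d ≥ 1 and 2 ≤ p < ∞. There is a constant C (depending only on d and p) such that for all n ∈ ℕ and all 1 ≤ m ≤ |Q_n|, the dyadic entropy numbers of the step hyperbolic cross projection satisfy e_m(S_{Q_n} : L_p(𝕋^d) → L_∞(𝕋^d)) ≤ C (2^n/m)^{1/p} n^{(d−1)(1−1/p) + 1/p}. -/

import Mathlib

open MeasureTheory Real
open scoped ENNReal ComplexConjugate Classical

noncomputable section

instance : Fact (0 < 2 * π) := ⟨by positivity⟩

/-- The `d`-dimensional torus `[0, 2π]^d`. -/
abbrev Torus (d : ℕ) := Fin d → AddCircle (2 * π)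

/-- The multivariate trigonometric character `x ↦ e^{i k · x}`. -/
def trigChar {d : ℕ} (k : Fin d → ℤ) : C(Torus d, ℂ) :=
  ⟨fun x => ∏ j, fourier (k j) (x j),
    continuous_finset_prod _ fun j _ => (map_continuous (fourier (k j))).comp (continuous_apply j)⟩

/-- The Fourier coefficient `f̂(k) = (2π)^{-d} ∫ f(x) e^{-i k·x} dx`. -/
def fCoeff {d : ℕ} (f : Torus d → ℂ) (k : Fin d → ℤ) : ℂ :=
  ((2 * π) ^ d)⁻¹ • ∫ x : Torus d, conj (trigChar k x) * f x

/-- A continuous function on the torus, considered as an element of `L_∞`. -/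
def toLinfty {d : ℕ} (g : C(Torus d, ℂ)) : Lp ℂ ∞ (volume : Measure (Torus d)) :=
  ContinuousMap.toLp ∞ (volume : Measure (Torus d)) ℂ g

/-- The Fourier projection `S_E f = ∑_{k ∈ E} f̂(k) e^{i k·x}`, as an operator from
`L_q(𝕋^d)` to `L_∞(𝕋^d)`. -/
def SE (d : ℕ) (q : ℝ≥0∞) (E : Finset (Fin d → ℤ))
    (f : Lp ℂ q (volume : Measure (Torus d))) : Lp ℂ ∞ (volume : Measure (Torus d)) :=
  toLinfty (∑ k ∈ E, fCoeff (f : Torus d → ℂ) k • trigChar k)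

/-- The dyadic block `ρ(s) = {k : ⌊2^{s_j - 1}⌋ ≤ |k_j| < 2^{s_j}, j = 1,…,d}`. -/
def inRho {d : ℕ} (s : Fin d → ℕ) (k : Fin d → ℤ) : Prop :=
  ∀ j, (2 ^ (s j) / 2 : ℤ) ≤ |k j| ∧ |k j| < 2 ^ (s j)

/-- The step hyperbolic cross `Q_n = ⋃_{‖s‖₁ ≤ n} ρ(s)` as a finite set of frequencies. -/
def hypCross (d n : ℕ) : Finset (Fin d → ℤ) :=
  (Finset.Icc (fun _ => -(2 ^ n : ℤ)) fun _ => (2 ^ n : ℤ)).filter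
    fun k => ∃ s : Fin d → ℕ, (∑ j, s j) ≤ n ∧ inRho s k

/-- Dyadic entropy numbers. -/
noncomputable def eN {A B : Type*} [Norm A] [NormedAddCommGroup B]
    (T : A → B) (m : ℕ) : ℝ :=
  sInf {ε : ℝ | 0 < ε ∧ ∃ S : Finset B, S.card ≤ 2 ^ (m - 1) ∧
    ∀ a : A, ‖a‖ ≤ 1 → ∃ b ∈ S, ‖T a - b‖ ≤ ε}

/-- `T` maps `P` into a union of at most `2 ^ b` balls of radius `ε`. -/
def Covers {α X : Type*} [NormedAddCommGroup X] (P : Set α) (T : α → X) (b : ℕ) (ε : ℝ) : Prop :=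
  ∃ S : Finset X, S.card ≤ 2 ^ b ∧ ∀ a ∈ P, ∃ y ∈ S, ‖T a - y‖ ≤ ε

theorem Covers.add {α X : Type*} [NormedAddCommGroup X] {P : Set α} {T T' : α → X}
    {b b' : ℕ} {ε ε' : ℝ} (h : Covers P T b ε) (h' : Covers P T' b' ε') :
    Covers P (fun a => T a + T' a) (b + b') (ε + ε') := by
  obtain ⟨S, hS, hT⟩ := h
  obtain ⟨S', hS', hT'⟩ := h'
  refine ⟨Finset.image₂ (· + ·) S S', ?_, fun a ha => ?_⟩
  · rw [pow_add]
    exact Finset.card_image₂_le _ _ _ |>.trans (Nat.mul_le_mul hS hS')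
  · obtain ⟨y, hy, hyε⟩ := hT a ha
    obtain ⟨y', hy', hyε'⟩ := hT' a ha
    refine ⟨y + y', Finset.mem_image₂_of_mem hy hy', ?_⟩
    rw [add_sub_add_comm]
    exact (norm_add_le _ _).trans (add_le_add hyε hyε')

theorem Covers.sum {α X κ : Type*} [NormedAddCommGroup X] {P : Set α} (Q : Finset κ)
    {T : κ → α → X} {b : κ → ℕ} {ε : κ → ℝ} (h : ∀ q ∈ Q, Covers P (T q) (b q) (ε q)) :
    Covers P (fun a => ∑ q ∈ Q, T q a) (∑ q ∈ Q, b q) (∑ q ∈ Q, ε q) := by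
  induction Q using Finset.induction_on with
  | empty => exact ⟨{0}, by simp, fun a _ => ⟨0, by simp⟩⟩
  | insert q Q hq ih =>
    simp only [Finset.sum_insert hq]
    exact (h q (by simp)).add (ih fun q' hq' => h q' (by simp [hq']))

theorem Covers.mono_radius {α X : Type*} [NormedAddCommGroup X] {P : Set α} {T : α → X}
    {b : ℕ} {ε ε' : ℝ} (h : Covers P T b ε) (hε : ε ≤ ε') : Covers P T b ε' := by
  obtain ⟨S, hS, hT⟩ := h
  refine ⟨S, hS, fun a ha => ?_⟩
  obtain ⟨y, hy, h⟩ := hT a ha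
  exact ⟨y, hy, h.trans hε⟩

theorem Covers.of_norm_le {α X : Type*} [NormedAddCommGroup X] {P : Set α} {T : α → X}
    {b : ℕ} {ε : ℝ} (h : ∀ a ∈ P, ‖T a‖ ≤ ε) : Covers P T b ε :=
  ⟨{0}, by simpa using Nat.one_le_two_pow, fun a ha => ⟨0, by simp, by simpa using h a ha⟩⟩

/-- The Gaussian weight on `ℝ^ι`. -/
def gaussWeight {ι : Type*} [Fintype ι] (y : ι → ℝ) : ℝ≥0∞ :=
  ENNReal.ofReal (exp (-(∑ i, y i ^ 2) / 2))

/-- The unnormalized Gaussian measure on `ℝ^ι`. -/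
def gaussMeasure (ι : Type*) [Fintype ι] : Measure (ι → ℝ) :=
  volume.withDensity gaussWeight

theorem measurable_gaussWeight {ι : Type*} [Fintype ι] :
    Measurable (gaussWeight (ι := ι)) := by
  unfold gaussWeight
  fun_prop

theorem gaussMeasure_univ_ne_top {ι : Type*} [Fintype ι] :
    gaussMeasure ι Set.univ ≠ ⊤ := by
  rw [gaussMeasure, withDensity_apply _ MeasurableSet.univ, Measure.restrict_univ]
  have h : Integrable (fun y : ι → ℝ => ∏ i, exp (-(1 / 2) * y i ^ 2)) :=
    Integrable.fintype_prod (f := fun _ t => exp (-(1 / 2) * t ^ 2))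
      (fun _ => integrable_exp_neg_mul_sq (by norm_num))
  have := h.lintegral_lt_top
  refine ne_of_lt (lt_of_le_of_lt (le_of_eq ?_) this)
  congr 1 with y
  rw [gaussWeight, ← exp_sum, ← Finset.mul_sum]
  congr 2
  ring

instance {ι : Type*} [Fintype ι] : IsFiniteMeasure (gaussMeasure ι) :=
  ⟨lt_top_iff_ne_top.2 gaussMeasure_univ_ne_top⟩

theorem gaussMeasure_univ_ne_zero {ι : Type*} [Fintype ι] :
    gaussMeasure ι Set.univ ≠ 0 := by
  rw [gaussMeasure, withDensity_apply _ MeasurableSet.univ, Measure.restrict_univ]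
  intro h0
  have h := (lintegral_eq_zero_iff measurable_gaussWeight).1 h0
  have h2 : ∀ y : ι → ℝ, gaussWeight y ≠ 0 := fun y => by
    simp [gaussWeight, exp_pos]
  have : (volume : Measure (ι → ℝ)) Set.univ = 0 := by
    refine measure_mono_null ?_ (ae_iff.1 h)
    intro y _
    simpa using h2 y
  exact (NeZero.ne (volume : Measure (ι → ℝ))) (Measure.measure_univ_eq_zero.1 this)

/-- The exponential moments of linear forms under the Gaussian measure. -/
theorem lintegral_exp_gaussMeasure {ι : Type*} [Fintype ι] (b : ι → ℝ) :
    ∫⁻ y, ENNReal.ofReal (exp (∑ i, b i * y i)) ∂gaussMeasure ι =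
      ENNReal.ofReal (exp ((∑ i, b i ^ 2) / 2)) * gaussMeasure ι Set.univ := by
  rw [gaussMeasure, lintegral_withDensity_eq_lintegral_mul _ measurable_gaussWeight (by fun_prop),
    withDensity_apply _ MeasurableSet.univ, Measure.restrict_univ,
    ← lintegral_const_mul _ measurable_gaussWeight,
    ← lintegral_add_right_eq_self _ b]
  congr 1 with y
  simp only [gaussWeight, Pi.mul_apply, Pi.add_apply]
  rw [← ENNReal.ofReal_mul (exp_pos _).le, ← ENNReal.ofReal_mul (exp_pos _).le, ← exp_add,
    ← exp_add]
  congr 2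
  have h1 : ∑ i, (y i + b i) ^ 2 = ∑ i, y i ^ 2 + 2 * ∑ i, b i * y i + ∑ i, b i ^ 2 := by
    rw [Finset.mul_sum, ← Finset.sum_add_distrib, ← Finset.sum_add_distrib]
    exact Finset.sum_congr rfl fun i _ => by ring
  have h2 : ∑ i, b i * (y i + b i) = ∑ i, b i * y i + ∑ i, b i ^ 2 := by
    rw [← Finset.sum_add_distrib]
    exact Finset.sum_congr rfl fun i _ => by ring
  rw [h1, h2]
  ring

/-- Translates of symmetric sets under the Gaussian measure. -/
theorem le_gaussMeasure_translate {ι : Type*} [Fintype ι] {A : Set (ι → ℝ)}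
    (hA : MeasurableSet A) (hsymm : ∀ y, -y ∈ A ↔ y ∈ A) (x : ι → ℝ) :
    ENNReal.ofReal (exp (-(∑ i, x i ^ 2) / 2)) * gaussMeasure ι A ≤
      gaussMeasure ι {y | y - x ∈ A} := by
  have hB : MeasurableSet {y : ι → ℝ | y - x ∈ A} :=
    (measurable_id.sub_const x) hA
  have e1 : gaussMeasure ι {y | y - x ∈ A} =
      ∫⁻ y, A.indicator (fun y => gaussWeight (y + x)) y := by
    rw [gaussMeasure, withDensity_apply _ hB, ← lintegral_indicator hB,
      ← lintegral_add_right_eq_self _ x]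
    congr 1 with y
    simp [Set.indicator]
  have e2 : gaussMeasure ι {y | y - x ∈ A} =
      ∫⁻ y, A.indicator (fun y => gaussWeight (y - x)) y := by
    rw [e1, ← lintegral_neg_eq_self]
    congr 1 with y
    simp only [Set.indicator, hsymm]
    congr 1
    unfold gaussWeight
    congr 3
    simp only [Pi.add_apply, Pi.sub_apply, Pi.neg_apply]
    congr 1
    exact Finset.sum_congr rfl fun i _ => by ring
  have hm : Measurable (A.indicator (fun y => gaussWeight (y + x))) :=
    (measurable_gaussWeight.comp (measurable_id.add_const x)).indicator hA
  have key : 2 * (ENNReal.ofReal (exp (-(∑ i, x i ^ 2) / 2)) * gaussMeasure ι A) ≤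
      2 * gaussMeasure ι {y | y - x ∈ A} := by
    rw [two_mul (gaussMeasure ι {y | y - x ∈ A})]
    nth_rewrite 1 [e1]
    rw [e2, ← lintegral_add_left hm, gaussMeasure, withDensity_apply _ hA,
      ← lintegral_indicator hA, ← lintegral_const_mul _ (measurable_gaussWeight.indicator hA),
      ← lintegral_const_mul _ ((measurable_gaussWeight.indicator hA).const_mul _)]
    refine lintegral_mono fun y => ?_
    by_cases hy : y ∈ A
    · simp only [Set.indicator, hy, if_true, gaussWeight]
      rw [← ENNReal.ofReal_mul (exp_pos _).le,
        ← ENNReal.ofReal_add (exp_pos _).le (exp_pos _).le,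
        show (2 : ℝ≥0∞) = ENNReal.ofReal 2 by simp, ← ENNReal.ofReal_mul (by norm_num)]
      refine ENNReal.ofReal_le_ofReal ?_
      have h1 : ∀ σ : ℝ, ∑ i, (y i + σ * x i) ^ 2 =
          ∑ i, y i ^ 2 + 2 * σ * ∑ i, x i * y i + σ ^ 2 * ∑ i, x i ^ 2 := fun σ => by
        rw [Finset.mul_sum, Finset.mul_sum, ← Finset.sum_add_distrib, ← Finset.sum_add_distrib]
        exact Finset.sum_congr rfl fun i _ => by ring
      have hp := h1 1
      have hn := h1 (-1)
      simp only [one_mul, neg_mul, ← sub_eq_add_neg] at hp hn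
      simp only [Pi.add_apply, Pi.sub_apply]
      rw [hp, hn, ← exp_add]
      set X := ∑ i, x i ^ 2
      set Y := ∑ i, y i ^ 2
      set W := ∑ i, x i * y i
      have a1 : exp (-(Y + 2 * 1 * W + 1 ^ 2 * X) / 2) = exp (-X / 2 + -Y / 2) * exp (-W) := by
        rw [← exp_add]; congr 1; ring
      have a2 : exp (-(Y + 2 * -1 * W + (-1) ^ 2 * X) / 2) = exp (-X / 2 + -Y / 2) * exp W := by
        rw [← exp_add]; congr 1; ring
      rw [a1, a2]
      have h2 : 2 ≤ exp (-W) + exp W := by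
        have := add_one_le_exp W
        have := add_one_le_exp (-W)
        linarith
      have h3 := exp_pos (-X / 2 + -Y / 2)
      nlinarith
    · simp [Set.indicator, hy]
  exact (ENNReal.mul_le_mul_iff_right (by norm_num) (by norm_num)).1 key

/-- A separated set in a Euclidean ball of radius `t` has few elements if the separation is large
compared to the Gaussian median of the seminorm. -/
theorem card_le_of_separated {ι X : Type*} [Fintype ι] [NormedAddCommGroup X] [NormedSpace ℝ X]
    (L : (ι → ℝ) →L[ℝ] X) {R t : ℝ}
    (hR : gaussMeasure ι Set.univ ≤ 2 * gaussMeasure ι {y | ‖L y‖ ≤ R}) (P : Finset (ι → ℝ))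
    (hP : ∀ x ∈ P, ∑ i, x i ^ 2 ≤ t ^ 2)
    (hsep : ∀ x ∈ P, ∀ x' ∈ P, x ≠ x' → 2 * R < ‖L x - L x'‖) :
    (P.card : ℝ) ≤ 2 * exp (t ^ 2 / 2) := by
  set A : Set (ι → ℝ) := {y | ‖L y‖ ≤ R} with hAdef
  have hA : MeasurableSet A := (isClosed_le (by fun_prop) continuous_const).measurableSet
  have hAm : ∀ x : ι → ℝ, MeasurableSet {y | y - x ∈ A} := fun x =>
    (measurable_id.sub_const x) hA
  set G := gaussMeasure ι Set.univ with hG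
  have hG0 : G ≠ 0 := gaussMeasure_univ_ne_zero
  have hGt : G ≠ ⊤ := gaussMeasure_univ_ne_top
  have hdisj : Set.PairwiseDisjoint (P : Set (ι → ℝ)) fun x => {y | y - x ∈ A} := by
    intro x hx x' hx' hne
    refine Set.disjoint_left.2 fun y hy hy' => ?_
    have h1 : ‖L (y - x)‖ ≤ R := hy
    have h2 : ‖L (y - x')‖ ≤ R := hy'
    have h3 := hsep x hx x' hx' hne
    have h4 : L x - L x' = L (y - x') - L (y - x) := by simp
    rw [h4] at h3
    linarith [norm_sub_le (L (y - x')) (L (y - x))]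
  have h1 : ∑ x ∈ P, gaussMeasure ι {y | y - x ∈ A} ≤ G := by
    rw [← measure_biUnion_finset hdisj fun x _ => hAm x]
    exact measure_mono (Set.subset_univ _)
  have h2 : ∀ x ∈ P, ENNReal.ofReal (exp (-t ^ 2 / 2)) * gaussMeasure ι A ≤
      gaussMeasure ι {y | y - x ∈ A} := fun x hx => by
    refine le_trans ?_ (le_gaussMeasure_translate hA (fun y => by simp [hAdef]) x)
    gcongr
    exact hP x hx
  have h3 : (P.card : ℝ≥0∞) * (ENNReal.ofReal (exp (-t ^ 2 / 2)) * gaussMeasure ι A) ≤ G := by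
    refine le_trans ?_ h1
    rw [← nsmul_eq_mul]
    exact Finset.card_nsmul_le_sum _ _ _ h2
  have h4 : (P.card : ℝ≥0∞) * ENNReal.ofReal (exp (-t ^ 2 / 2)) * G ≤ 2 * G := by
    calc _ ≤ (P.card : ℝ≥0∞) * ENNReal.ofReal (exp (-t ^ 2 / 2)) * (2 * gaussMeasure ι A) := by
          gcongr
      _ = 2 * ((P.card : ℝ≥0∞) * (ENNReal.ofReal (exp (-t ^ 2 / 2)) * gaussMeasure ι A)) := by ring
      _ ≤ 2 * G := by gcongr
  have h5 := (ENNReal.mul_le_mul_iff_left hG0 hGt).1 h4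
  have h6 : (P.card : ℝ) * exp (-t ^ 2 / 2) ≤ 2 := by
    have := ENNReal.toReal_mono (by norm_num) h5
    simpa [ENNReal.toReal_mul, ENNReal.toReal_ofReal (exp_pos _).le] using this
  have h7 : exp (-t ^ 2 / 2) * exp (t ^ 2 / 2) = 1 := by
    rw [← exp_add, ← exp_zero]; congr 1; ring
  calc (P.card : ℝ) = P.card * exp (-t ^ 2 / 2) * exp (t ^ 2 / 2) := by rw [mul_assoc, h7, mul_one]
    _ ≤ _ := by gcongr

/-- The dual Sudakov inequality for a fixed scale. -/
theorem covers_of_gaussMeasure {ι X : Type*} [Fintype ι] [NormedAddCommGroup X] [NormedSpace ℝ X]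
    (L : (ι → ℝ) →L[ℝ] X) {R t : ℝ} (ht : 0 < t)
    (hR : gaussMeasure ι Set.univ ≤ 2 * gaussMeasure ι {y | ‖L y‖ ≤ R}) {b : ℕ}
    (hb : 2 * exp (t ^ 2 / 2) ≤ 2 ^ b) :
    Covers {x : ι → ℝ | ∑ i, x i ^ 2 ≤ 1} L b (2 * R / t) := by
  let good : Finset (ι → ℝ) → Prop := fun P => (∀ x ∈ P, ∑ i, x i ^ 2 ≤ t ^ 2) ∧
    ∀ x ∈ P, ∀ x' ∈ P, x ≠ x' → 2 * R < ‖L x - L x'‖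
  have hcard : ∀ P, good P → P.card ≤ 2 ^ b := fun P hP => by
    have := (card_le_of_separated L hR P hP.1 hP.2).trans hb
    exact_mod_cast this
  obtain ⟨P, hP, hmax⟩ : ∃ P, good P ∧ ∀ P', good P' → P'.card ≤ P.card := by
    obtain ⟨P, hP, hPc⟩ := Nat.findGreatest_spec (P := fun k => ∃ P, good P ∧ P.card = k)
      (Nat.zero_le (2 ^ b)) ⟨∅, by simp [good], rfl⟩
    refine ⟨P, hP, fun P' hP' => ?_⟩
    rw [hPc]
    exact Nat.le_findGreatest (hcard P' hP') ⟨P', hP', rfl⟩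
  refine ⟨P.image fun x => t⁻¹ • L x, Finset.card_image_le.trans (hcard P hP), fun x hx => ?_⟩
  have hx1 : ∑ i, x i ^ 2 ≤ 1 := hx
  suffices h : ∃ y ∈ P, ‖L (t • x) - L y‖ ≤ 2 * R by
    obtain ⟨y, hy, hy2⟩ := h
    refine ⟨t⁻¹ • L y, Finset.mem_image_of_mem _ hy, ?_⟩
    have e : L x - t⁻¹ • L y = t⁻¹ • (L (t • x) - L y) := by
      rw [map_smul, smul_sub, smul_smul, inv_mul_cancel₀ ht.ne', one_smul]
    rw [e, norm_smul, norm_inv, Real.norm_of_nonneg ht.le, div_eq_inv_mul]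
    gcongr
  by_contra! hcon
  have htx : ∑ i, (t • x) i ^ 2 ≤ t ^ 2 := by
    simp only [Pi.smul_apply, smul_eq_mul, mul_pow]
    rw [← Finset.mul_sum]
    exact mul_le_of_le_one_right (sq_nonneg t) hx1
  have hR0 : 0 ≤ R := by
    by_contra! hneg
    have : {y : ι → ℝ | ‖L y‖ ≤ R} = ∅ := by
      ext y
      simpa using hneg.trans_le (norm_nonneg _)
    rw [this, measure_empty, mul_zero] at hR
    exact gaussMeasure_univ_ne_zero (le_antisymm hR bot_le)
  have hnot : t • x ∉ P := fun h => by
    have := hcon _ h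
    simp at this
    linarith
  have hgood : good (insert (t • x) P) := by
    refine ⟨fun z hz => ?_, fun z hz z' hz' hne => ?_⟩
    · rcases Finset.mem_insert.1 hz with rfl | hz
      · exact htx
      · exact hP.1 z hz
    · rcases Finset.mem_insert.1 hz with rfl | hz <;> rcases Finset.mem_insert.1 hz' with rfl | hz'
      · exact absurd rfl hne
      · exact hcon _ hz'
      · rw [norm_sub_rev]
        exact hcon _ hz
      · exact hP.2 z hz z' hz' hne
  have := hmax _ hgood
  rw [Finset.card_insert_of_notMem hnot] at this
  omega

theorem pow_le_factorial_mul_exp {u : ℝ} (hu : 0 ≤ u) (k : ℕ) : u ^ k ≤ k.factorial * exp u := by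
  have := pow_div_factorial_le_exp u hu k
  rw [div_le_iff₀ (by positivity)] at this
  linarith

/-- Even Gaussian moments of a complex linear form. -/
theorem lintegral_norm_pow_gaussMeasure_le {ι : Type*} [Fintype ι] (v : ι → ℂ) {N : ℝ}
    (hN : 0 < N) (hv : ∑ i, ‖v i‖ ^ 2 ≤ 2 * N) {j : ℕ} (hj : 1 ≤ j) :
    ∫⁻ y, ENNReal.ofReal (‖∑ i, (y i : ℂ) * v i‖ ^ (2 * j)) ∂gaussMeasure ι ≤
      ENNReal.ofReal (4 * (32 * j * N) ^ j) * gaussMeasure ι Set.univ := by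
  set θ : ℝ := √(j / N) with hθ
  have hj0 : (0 : ℝ) < j := by exact_mod_cast hj
  have hθ0 : 0 < θ := sqrt_pos.2 (by positivity)
  have hθ2 : θ ^ 2 = j / N := sq_sqrt (by positivity)
  let c : Bool → Bool → ι → ℝ := fun a a' i =>
    θ * ((if a then 1 else -1) * (v i).re + (if a' then 1 else -1) * (v i).im)
  have hc : ∀ a a', (∑ i, c a a' i ^ 2) / 2 ≤ 2 * j := by
    intro a a'
    have h1 : ∑ i, c a a' i ^ 2 ≤ ∑ i, θ ^ 2 * (2 * ‖v i‖ ^ 2) := by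
      refine Finset.sum_le_sum fun i _ => ?_
      simp only [c, mul_pow]
      gcongr
      rw [← Complex.normSq_eq_norm_sq, Complex.normSq_apply]
      cases a <;> cases a' <;> simp <;>
        nlinarith [sq_nonneg ((v i).re + (v i).im), sq_nonneg ((v i).re - (v i).im)]
    rw [← Finset.mul_sum, ← Finset.mul_sum, hθ2] at h1
    have h2 : j / N * (2 * ∑ i, ‖v i‖ ^ 2) ≤ j / N * (2 * (2 * N)) := by gcongr
    have h3 : j / N * (2 * (2 * N)) = 4 * j := by field_simp; ring
    linarith
  have hpt : ∀ y : ι → ℝ, ‖∑ i, (y i : ℂ) * v i‖ ^ (2 * j) ≤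
      ((2 * j).factorial / θ ^ (2 * j)) * ∑ a, ∑ a', exp (∑ i, c a a' i * y i) := by
    intro y
    set z := ∑ i, (y i : ℂ) * v i with hz
    have hre : z.re = ∑ i, (v i).re * y i := by
      simp [hz, mul_comm]
    have him : z.im = ∑ i, (v i).im * y i := by
      simp [hz, mul_comm]
    have hsum : ∀ a a', ∑ i, c a a' i * y i =
        θ * ((if a then 1 else -1) * z.re + (if a' then 1 else -1) * z.im) := by
      intro a a'
      rw [hre, him, Finset.mul_sum, Finset.mul_sum, ← Finset.sum_add_distrib, Finset.mul_sum]
      exact Finset.sum_congr rfl fun i _ => by simp only [c]; ring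
    have h1 : exp (θ * ‖z‖) ≤ ∑ a, ∑ a', exp (∑ i, c a a' i * y i) := by
      have h2 : ‖z‖ ≤ |z.re| + |z.im| := Complex.norm_le_abs_re_add_abs_im z
      obtain ⟨a, ha⟩ : ∃ a : Bool, |z.re| = (if a then 1 else -1) * z.re := by
        rcases abs_choice z.re with h | h
        · exact ⟨true, by simpa using h⟩
        · exact ⟨false, by simpa using h⟩
      obtain ⟨a', ha'⟩ : ∃ a : Bool, |z.im| = (if a then 1 else -1) * z.im := by
        rcases abs_choice z.im with h | h
        · exact ⟨true, by simpa using h⟩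
        · exact ⟨false, by simpa using h⟩
      calc exp (θ * ‖z‖) ≤ exp (∑ i, c a a' i * y i) := by
            rw [hsum, ← ha, ← ha']; gcongr
        _ ≤ ∑ a', exp (∑ i, c a a' i * y i) :=
            Finset.single_le_sum (f := fun a' => exp (∑ i, c a a' i * y i))
              (fun _ _ => (exp_pos _).le) (Finset.mem_univ a')
        _ ≤ _ := Finset.single_le_sum (f := fun a => ∑ a', exp (∑ i, c a a' i * y i))
              (fun _ _ => Finset.sum_nonneg fun _ _ => (exp_pos _).le) (Finset.mem_univ a)
    have h3 := pow_le_factorial_mul_exp (mul_nonneg hθ0.le (norm_nonneg z)) (2 * j)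
    rw [mul_pow] at h3
    rw [div_mul_eq_mul_div, le_div_iff₀ (by positivity), mul_comm]
    exact h3.trans (by gcongr)
  have hK : (0 : ℝ) ≤ (2 * j).factorial / θ ^ (2 * j) := by positivity
  calc _ ≤ ∫⁻ y, ENNReal.ofReal ((2 * j).factorial / θ ^ (2 * j)) *
        ∑ a, ∑ a', ENNReal.ofReal (exp (∑ i, c a a' i * y i)) ∂gaussMeasure ι := by
        refine lintegral_mono fun y => ?_
        refine (ENNReal.ofReal_le_ofReal (hpt y)).trans (le_of_eq ?_)
        rw [ENNReal.ofReal_mul hK, ENNReal.ofReal_sum_of_nonneg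
          fun _ _ => Finset.sum_nonneg fun _ _ => (exp_pos _).le]
        congr 1
        exact Finset.sum_congr rfl fun a _ =>
          ENNReal.ofReal_sum_of_nonneg fun _ _ => (exp_pos _).le
    _ = ENNReal.ofReal ((2 * j).factorial / θ ^ (2 * j)) *
        ∑ a, ∑ a', ENNReal.ofReal (exp ((∑ i, c a a' i ^ 2) / 2)) *
          gaussMeasure ι Set.univ := by
        rw [lintegral_const_mul _ (by fun_prop), lintegral_finsetSum _ (by fun_prop)]
        congr 1
        refine Finset.sum_congr rfl fun a _ => ?_
        rw [lintegral_finsetSum _ (by fun_prop)]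
        exact Finset.sum_congr rfl fun a' _ => lintegral_exp_gaussMeasure _
    _ ≤ ENNReal.ofReal ((2 * j).factorial / θ ^ (2 * j)) *
        ∑ _a : Bool, ∑ _a' : Bool, ENNReal.ofReal (exp (2 * j)) * gaussMeasure ι Set.univ := by
        gcongr
        exact hc _ _
    _ = ENNReal.ofReal ((2 * j).factorial / θ ^ (2 * j) * (4 * exp (2 * j))) *
          gaussMeasure ι Set.univ := by
        rw [ENNReal.ofReal_mul hK, ENNReal.ofReal_mul (by norm_num : (0 : ℝ) ≤ 4),
          show ENNReal.ofReal 4 = 4 by simp]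
        simp only [Finset.sum_const, Finset.card_univ, Fintype.card_bool, nsmul_eq_mul]
        push_cast
        ring
    _ ≤ _ := by
        refine mul_le_mul_left (ENNReal.ofReal_le_ofReal ?_) _
        have h1 : ((2 * j).factorial : ℝ) ≤ (2 * j) ^ (2 * j) := by
          exact_mod_cast Nat.factorial_le_pow (2 * j)
        have h2 : exp (2 * j) ≤ 8 ^ j := by
          rw [mul_comm, exp_nat_mul]
          gcongr
          have h := exp_one_lt_d9
          have h' : exp 2 = exp 1 * exp 1 := by rw [← exp_add]; norm_num
          have := exp_pos 1
          rw [h']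
          nlinarith
        have h3 : θ ^ (2 * j) = (j / N) ^ j := by rw [pow_mul, hθ2]
        have h4 : (2 * j : ℝ) ^ (2 * j) = (4 * j * j) ^ j := by
          rw [pow_mul]; congr 1; ring
        rw [h3]
        calc _ ≤ (2 * j : ℝ) ^ (2 * j) / (j / N) ^ j * (4 * 8 ^ j) := by gcongr
          _ = 4 * (32 * j * N) ^ j := by
            rw [h4, ← div_pow, mul_left_comm, ← mul_pow]
            congr 2
            field_simp
            ring

theorem ContinuousMap.integrable_of_compactSpace {X : Type*} [TopologicalSpace X] [CompactSpace X]
    [MeasurableSpace X] [OpensMeasurableSpace X] {μ : Measure X} [IsFiniteMeasure μ]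
    {F : Type*} [NormedAddCommGroup F] [SecondCountableTopology F] {f : X → F} (hf : Continuous f) : Integrable f μ :=
  hf.integrable_of_hasCompactSupport (HasCompactSupport.of_compactSpace f)

/-- Parseval's identity for finite orthogonal sums. -/
theorem integral_norm_sq_sum {X κ : Type*} [DecidableEq κ] [MeasurableSpace X] {μ : Measure X} (e : κ → X → ℂ)
    {V : ℝ} (he : ∀ k l, Integrable (fun x => conj (e k x) * e l x) μ)
    (horth : ∀ k l, ∫ x, conj (e k x) * e l x ∂μ = if k = l then (V : ℂ) else 0)
    (F : Finset κ) (c : κ → ℂ) :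
    ∫ x, ‖∑ k ∈ F, c k * e k x‖ ^ 2 ∂μ = V * ∑ k ∈ F, ‖c k‖ ^ 2 := by
  have h1 : ∀ x, ((‖∑ k ∈ F, c k * e k x‖ ^ 2 : ℝ) : ℂ) =
      ∑ k ∈ F, ∑ l ∈ F, conj (c k) * c l * (conj (e k x) * e l x) := by
    intro x
    rw [Complex.ofReal_pow, ← Complex.conj_mul', map_sum, Finset.sum_mul_sum]
    refine Finset.sum_congr rfl fun k _ => Finset.sum_congr rfl fun l _ => ?_
    rw [map_mul]
    ring
  have h2 : ((∫ x, ‖∑ k ∈ F, c k * e k x‖ ^ 2 ∂μ : ℝ) : ℂ) =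
      ((V * ∑ k ∈ F, ‖c k‖ ^ 2 : ℝ) : ℂ) := by
    rw [← integral_complex_ofReal]
    simp_rw [h1]
    rw [integral_finsetSum _ fun k _ => integrable_finsetSum _ fun l _ => (he k l).const_mul _]
    simp_rw [integral_finsetSum _ fun l _ => (he _ l).const_mul _, integral_const_mul, horth]
    push_cast
    rw [Finset.mul_sum]
    refine Finset.sum_congr rfl fun k hk => ?_
    simp only [mul_ite, mul_zero, Finset.sum_ite_eq, hk, if_true]
    rw [Complex.conj_mul']
    ring
  exact_mod_cast h2

theorem integral_fourier_two_pi (n : ℤ) :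
    ∫ x : AddCircle (2 * π), (fourier n x : ℂ) = if n = 0 then ((2 * π : ℝ) : ℂ) else 0 := by
  split_ifs with h
  · subst h
    simp [AddCircle.measure_univ, Measure.real, pi_pos.le]
  · exact integral_eq_zero_of_add_right_eq_neg
      (fourier_add_half_inv_index h (Fact.out : 0 < 2 * π))

theorem integral_conj_fourier_mul (k l : ℤ) :
    ∫ x : AddCircle (2 * π), conj (fourier k x : ℂ) * fourier l x =
      if k = l then ((2 * π : ℝ) : ℂ) else 0 := by
  simp_rw [← fourier_neg, ← fourier_add, integral_fourier_two_pi]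
  congr 1
  simp only [eq_iff_iff]
  constructor <;> intro <;> omega

theorem trigChar_apply {d : ℕ} (k : Fin d → ℤ) (x : Torus d) :
    trigChar k x = ∏ j, (fourier (k j) (x j) : ℂ) := rfl

theorem norm_trigChar_apply {d : ℕ} (k : Fin d → ℤ) (x : Torus d) : ‖trigChar k x‖ = 1 := by
  simp only [trigChar_apply, fourier_apply, norm_prod, Circle.norm_coe, Finset.prod_const_one]

theorem trigChar_add {d : ℕ} (k l : Fin d → ℤ) : trigChar (k + l) = trigChar k * trigChar l := by
  ext x
  simp [trigChar_apply, Finset.prod_mul_distrib]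

theorem trigChar_sub_apply {d : ℕ} (k : Fin d → ℤ) (x y : Torus d) :
    trigChar k (x - y) = trigChar k x * conj (trigChar k y) := by
  simp only [trigChar_apply, map_prod, ← Finset.prod_mul_distrib]
  refine Finset.prod_congr rfl fun j _ => ?_
  rw [← fourier_neg]
  simp [fourier_apply, sub_eq_add_neg, AddCircle.toCircle_add]

theorem integral_conj_trigChar_mul {d : ℕ} (k l : Fin d → ℤ) :
    ∫ x : Torus d, conj (trigChar k x) * trigChar l x =
      if k = l then (((2 * π) ^ d : ℝ) : ℂ) else 0 := by
  simp only [trigChar_apply, map_prod, ← Finset.prod_mul_distrib]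
  rw [integral_fintype_prod_volume_eq_prod
    (f := fun j (t : AddCircle (2 * π)) => conj (fourier (k j) t : ℂ) * fourier (l j) t)]
  simp_rw [integral_conj_fourier_mul]
  split_ifs with h
  · subst h
    simp
  · obtain ⟨j, hj⟩ := Function.ne_iff.1 h
    exact Finset.prod_eq_zero (Finset.mem_univ j) (by simp [hj])

/-- The trigonometric polynomial with frequencies in `E` and coefficients `c`. -/
def trigPoly {d : ℕ} (E : Finset (Fin d → ℤ)) (c : (Fin d → ℤ) → ℂ) : C(Torus d, ℂ) :=
  ∑ k ∈ E, c k • trigChar k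

theorem trigPoly_apply {d : ℕ} (E : Finset (Fin d → ℤ)) (c : (Fin d → ℤ) → ℂ) (x : Torus d) :
    trigPoly E c x = ∑ k ∈ E, c k * trigChar k x := by
  simp [trigPoly]

theorem integral_norm_sq_trigPoly {d : ℕ} (E : Finset (Fin d → ℤ)) (c : (Fin d → ℤ) → ℂ) :
    ∫ x : Torus d, ‖trigPoly E c x‖ ^ 2 = (2 * π) ^ d * ∑ k ∈ E, ‖c k‖ ^ 2 := by
  simp_rw [trigPoly_apply]
  exact integral_norm_sq_sum (fun k x => trigChar k x)
    (fun k l => ContinuousMap.integrable_of_compactSpace (by fun_prop))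
    integral_conj_trigChar_mul E c

/-- The Nikolskii inequality between `L_∞` and `L_2`. -/
theorem norm_sq_trigPoly_le {d : ℕ} (E : Finset (Fin d → ℤ)) (c : (Fin d → ℤ) → ℂ) :
    ‖trigPoly E c‖ ^ 2 ≤ E.card * ((2 * π) ^ d)⁻¹ * ∫ x : Torus d, ‖trigPoly E c x‖ ^ 2 := by
  rw [integral_norm_sq_trigPoly, mul_assoc, inv_mul_cancel_left₀ (by positivity)]
  have h : ‖trigPoly E c‖ ≤ √(E.card * ∑ k ∈ E, ‖c k‖ ^ 2) := by
    refine (ContinuousMap.norm_le _ (sqrt_nonneg _)).2 fun x => le_sqrt_of_sq_le ?_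
    have h1 : ‖trigPoly E c x‖ ≤ ∑ k ∈ E, ‖c k‖ := by
      rw [trigPoly_apply]
      refine (norm_sum_le _ _).trans (le_of_eq ?_)
      simp [norm_trigChar_apply]
    calc _ ≤ (∑ k ∈ E, ‖c k‖) ^ 2 := by gcongr
      _ ≤ _ := sq_sum_le_card_mul_sum_sq
  calc _ ≤ √(E.card * ∑ k ∈ E, ‖c k‖ ^ 2) ^ 2 := by gcongr
    _ = _ := sq_sqrt (by positivity)

/-- The cube of frequencies `k` with `|k_j| ≤ W`. -/
def freqBox (d W : ℕ) : Finset (Fin d → ℤ) :=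
  Fintype.piFinset fun _ => Finset.Icc (-(W : ℤ)) W

theorem mem_freqBox {d W : ℕ} {k : Fin d → ℤ} : k ∈ freqBox d W ↔ ∀ j, |k j| ≤ W := by
  simp [freqBox, abs_le]

theorem card_freqBox (d W : ℕ) : (freqBox d W).card = (2 * W + 1) ^ d := by
  rw [freqBox, Fintype.card_piFinset]
  simp only [Int.card_Icc, Finset.prod_const, Finset.card_univ, Fintype.card_fin]
  congr 1
  omega

/-- The trigonometric polynomials of coordinate degree at most `W`. -/
def polySpace (d W : ℕ) : Submodule ℂ C(Torus d, ℂ) :=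
  Submodule.span ℂ (trigChar '' (freqBox d W : Set (Fin d → ℤ)))

theorem exists_eq_trigPoly {d W : ℕ} {h : C(Torus d, ℂ)} (hh : h ∈ polySpace d W) :
    ∃ c, h = trigPoly (freqBox d W) c := by
  obtain ⟨c, hc⟩ := (Submodule.mem_span_image_finset_iff_exists_fun ℂ).1 hh
  refine ⟨fun k => if hk : k ∈ freqBox d W then c ⟨k, hk⟩ else 0, ?_⟩
  rw [← hc, trigPoly, ← Finset.sum_coe_sort (freqBox d W)]
  exact Finset.sum_congr rfl fun k _ => by simp

theorem trigChar_mem_polySpace {d W : ℕ} {k : Fin d → ℤ} (hk : k ∈ freqBox d W) :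
    trigChar k ∈ polySpace d W :=
  Submodule.subset_span ⟨k, hk, rfl⟩

theorem mul_mem_polySpace {d W W' : ℕ} {h h' : C(Torus d, ℂ)} (hh : h ∈ polySpace d W)
    (hh' : h' ∈ polySpace d W') : h * h' ∈ polySpace d (W + W') := by
  have h1 := Submodule.mul_mem_mul hh hh'
  rw [polySpace, polySpace, Submodule.span_mul_span] at h1
  refine Submodule.span_mono ?_ h1
  rintro _ ⟨_, ⟨k, hk, rfl⟩, _, ⟨l, hl, rfl⟩, rfl⟩
  refine ⟨k + l, ?_, trigChar_add k l⟩
  simp only [Finset.mem_coe, mem_freqBox] at hk hl ⊢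
  intro j
  push_cast
  exact (abs_add_le _ _).trans (add_le_add (hk j) (hl j))

theorem pow_mem_polySpace {d W : ℕ} {h : C(Torus d, ℂ)} (hh : h ∈ polySpace d W) (j : ℕ) :
    h ^ j ∈ polySpace d (j * W) := by
  induction j with
  | zero =>
    have : (1 : C(Torus d, ℂ)) = trigChar 0 := by
      ext x
      simp [trigChar_apply]
    rw [pow_zero, this]
    exact trigChar_mem_polySpace (by simp [mem_freqBox])
  | succ j ih =>
    rw [pow_succ, add_mul, one_mul]
    exact mul_mem_polySpace ih hh

/-- The Nikolskii inequality between the uniform norm and even moments. -/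
theorem norm_pow_le_of_mem_polySpace {d W : ℕ} {h : C(Torus d, ℂ)} (hh : h ∈ polySpace d W)
    (j : ℕ) :
    ‖h‖ ^ (2 * j) ≤ (2 * (j * W) + 1) ^ d * ((2 * π) ^ d)⁻¹ *
      ∫ x : Torus d, ‖h x‖ ^ (2 * j) := by
  obtain ⟨c, hc⟩ := exists_eq_trigPoly (pow_mem_polySpace hh j)
  have h1 := norm_sq_trigPoly_le (freqBox d (j * W)) c
  rw [← hc, card_freqBox] at h1
  have h2 : ‖h‖ ^ j ≤ ‖h ^ j‖ := by
    have h0 : (0 : ℝ) ≤ ‖h ^ j‖ := norm_nonneg _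
    rcases Nat.eq_zero_or_pos j with rfl | hj
    · simp
    have h3 : ‖h‖ ≤ ‖h ^ j‖ ^ ((1 : ℝ) / j) := by
      refine (ContinuousMap.norm_le _ (by positivity)).2 fun x => ?_
      have h4 : ‖h x‖ ^ j ≤ ‖h ^ j‖ := by
        rw [← norm_pow]
        exact (h ^ j).norm_coe_le_norm x
      rw [one_div, Real.le_rpow_inv_iff_of_pos (norm_nonneg _) h0 (by exact_mod_cast hj),
        rpow_natCast]
      exact h4
    calc _ ≤ (‖h ^ j‖ ^ ((1 : ℝ) / j)) ^ j := by gcongr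
      _ = _ := by
        rw [← rpow_natCast, ← rpow_mul h0, one_div, inv_mul_cancel₀ (by positivity), rpow_one]
  calc ‖h‖ ^ (2 * j) = (‖h‖ ^ j) ^ 2 := pow_mul' _ _ _
    _ ≤ ‖h ^ j‖ ^ 2 := by gcongr
    _ ≤ _ := h1
    _ = _ := by
      push_cast
      congr 2 with x
      rw [norm_pow, pow_mul']

theorem Covers.comp {α β X : Type*} [NormedAddCommGroup X] {P : Set α} {T : α → X}
    {b : ℕ} {ε : ℝ} (h : Covers P T b ε) {P' : Set β} (φ : β → α) (hφ : ∀ x ∈ P', φ x ∈ P) :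
    Covers P' (fun x => T (φ x)) b ε := by
  obtain ⟨S, hS, hT⟩ := h
  exact ⟨S, hS, fun x hx => hT _ (hφ x hx)⟩

theorem volume_torus_univ (d : ℕ) :
    (volume : Measure (Torus d)) Set.univ = ENNReal.ofReal ((2 * π) ^ d) := by
  rw [volume_pi, Measure.pi_univ]
  simp only [AddCircle.measure_univ, Finset.prod_const, Finset.card_univ, Fintype.card_fin]
  rw [ENNReal.ofReal_pow two_pi_pos.le]

/-- A Gaussian random trigonometric polynomial has sup norm of order `√(n N)`, where `N` is the
pointwise variance and `2 ^ n` the degree. -/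
theorem gaussMeasure_univ_le_of_polySpace {d n : ℕ} (hn : 1 ≤ n) {ι : Type*} [Fintype ι]
    (v : ι → C(Torus d, ℂ)) (hv : ∀ i, v i ∈ polySpace d (2 ^ n)) {N : ℝ} (hN : 0 < N)
    (hvN : ∀ x, ∑ i, ‖v i x‖ ^ 2 ≤ 2 * N) (L : (ι → ℝ) →L[ℝ] C(Torus d, ℂ))
    (hL : ∀ y, L y = ∑ i, (y i : ℂ) • v i) :
    gaussMeasure ι Set.univ ≤
      2 * gaussMeasure ι {y | ‖L y‖ ≤ √(256 * 16 ^ d * (n * N))} := by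
  set G := gaussMeasure ι Set.univ with hG
  set R := √(256 * 16 ^ d * (n * N)) with hRdef
  have hn0 : (0 : ℝ) < n := by exact_mod_cast hn
  have hR0 : 0 < R := sqrt_pos.2 (by positivity)
  set Λ : ℝ := (2 * (n * (2 ^ n : ℕ)) + 1) ^ d * (4 * (32 * n * N) ^ n) with hΛ
  have hΛ0 : 0 < Λ := by positivity
  have hΛR : 2 * Λ ≤ R ^ (2 * n) := by
    rw [pow_mul, hRdef, sq_sqrt (by positivity)]
    have h1 : (2 * (n * (2 ^ n : ℕ)) + 1 : ℝ) ≤ 16 ^ n := by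
      have h2 : n + 1 ≤ 2 ^ n := Nat.lt_two_pow_self
      have h3 : (2 : ℕ) ≤ 2 ^ n := le_self_pow₀ (by norm_num) (by omega)
      have h4 : 16 ^ n = (2 ^ n) * (2 ^ n) * ((2 ^ n) * (2 ^ n)) := by
        rw [← mul_pow, ← mul_pow]
        norm_num
      have h5 : 2 * (n * 2 ^ n) + 1 ≤ 16 ^ n := by
        rw [h4]
        generalize 2 ^ n = w at *
        nlinarith [Nat.mul_le_mul h3 h3, Nat.mul_le_mul h2 (le_refl w)]
      exact_mod_cast h5
    have h6 : (8 : ℝ) ≤ 8 ^ n := le_self_pow₀ (by norm_num) (by omega)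
    calc 2 * Λ = (2 * (n * (2 ^ n : ℕ)) + 1) ^ d * (8 * (32 * n * N) ^ n) := by rw [hΛ]; ring
      _ ≤ (16 ^ n) ^ d * (8 ^ n * (32 * n * N) ^ n) := by gcongr
      _ = (256 * 16 ^ d * (n * N)) ^ n := by
        rw [← pow_mul, mul_comm n d, pow_mul, ← mul_pow, ← mul_pow]
        congr 1
        ring
  have hmeas : Measurable fun y : ι → ℝ => ENNReal.ofReal (‖L y‖ ^ (2 * n)) :=
    ((L.continuous.norm).pow _).measurable.ennreal_ofReal
  have hjoint : Measurable (Function.uncurry fun (y : ι → ℝ) (x : Torus d) =>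
      ENNReal.ofReal (‖L y x‖ ^ (2 * n))) := by
    have : Function.uncurry (fun (y : ι → ℝ) (x : Torus d) => ENNReal.ofReal (‖L y x‖ ^ (2 * n))) =
        fun q => ENNReal.ofReal (‖∑ i, (q.1 i : ℂ) * v i q.2‖ ^ (2 * n)) := by
      ext q
      simp [Function.uncurry, hL]
    rw [this]
    fun_prop
  have hmem : ∀ y, L y ∈ polySpace d (2 ^ n) := fun y => by
    rw [hL]
    exact Submodule.sum_mem _ fun i _ => Submodule.smul_mem _ _ (hv i)
  have hmom : ∫⁻ y, ENNReal.ofReal (‖L y‖ ^ (2 * n)) ∂gaussMeasure ι ≤ ENNReal.ofReal Λ * G := by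
    set κ : ℝ := (2 * (n * (2 ^ n : ℕ)) + 1) ^ d * ((2 * π) ^ d)⁻¹ with hκ
    have hκ0 : 0 ≤ κ := by positivity
    calc _ ≤ ∫⁻ y, ENNReal.ofReal κ * (∫⁻ x, ENNReal.ofReal (‖L y x‖ ^ (2 * n)))
          ∂gaussMeasure ι := by
          refine lintegral_mono fun y => ?_
          rw [← ofReal_integral_eq_lintegral_ofReal
            ((by fun_prop : Continuous fun x => ‖L y x‖ ^ (2 * n)).integrable_of_hasCompactSupport
              (HasCompactSupport.of_compactSpace _)) (ae_of_all _ fun x => by positivity),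
            ← ENNReal.ofReal_mul hκ0]
          exact ENNReal.ofReal_le_ofReal (norm_pow_le_of_mem_polySpace (hmem y) n)
      _ = ENNReal.ofReal κ * ∫⁻ x, ∫⁻ y, ENNReal.ofReal (‖L y x‖ ^ (2 * n)) ∂gaussMeasure ι := by
          have hm : Measurable fun y => ∫⁻ x, ENNReal.ofReal (‖L y x‖ ^ (2 * n)) :=
            hjoint.lintegral_prod_right'
          rw [lintegral_const_mul _ hm,
            lintegral_lintegral_swap hjoint.aemeasurable]
      _ ≤ ENNReal.ofReal κ * ∫⁻ _x : Torus d, ENNReal.ofReal (4 * (32 * n * N) ^ n) * G := by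
          gcongr with x
          have := lintegral_norm_pow_gaussMeasure_le (fun i => v i x) hN (hvN x) hn
          simpa [hL] using this
      _ = ENNReal.ofReal Λ * G := by
          have hκΛ : κ * (4 * (32 * n * N) ^ n * (2 * π) ^ d) = Λ := by
            rw [hκ, hΛ]
            field_simp
          rw [lintegral_const, volume_torus_univ, mul_right_comm, ← mul_assoc,
            ← ENNReal.ofReal_mul (by positivity), ← ENNReal.ofReal_mul hκ0, hκΛ]
  have hmark := mul_meas_ge_le_lintegral (μ := gaussMeasure ι) hmeas (ENNReal.ofReal (R ^ (2 * n)))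
  set B := {y : ι → ℝ | ‖L y‖ ≤ R} with hB
  have hBm : MeasurableSet B := (isClosed_le (by fun_prop) continuous_const).measurableSet
  have hsub : Bᶜ ⊆ {y | ENNReal.ofReal (R ^ (2 * n)) ≤ ENNReal.ofReal (‖L y‖ ^ (2 * n))} := by
    intro y hy
    have : R < ‖L y‖ := not_le.1 hy
    exact ENNReal.ofReal_le_ofReal (by gcongr)
  have h1 : ENNReal.ofReal Λ * (2 * gaussMeasure ι Bᶜ) ≤ ENNReal.ofReal Λ * G := by
    calc _ = ENNReal.ofReal (2 * Λ) * gaussMeasure ι Bᶜ := by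
          rw [ENNReal.ofReal_mul (p := 2) (q := Λ) (by norm_num), show ENNReal.ofReal 2 = 2 by simp]
          ring
      _ ≤ ENNReal.ofReal (R ^ (2 * n)) *
          gaussMeasure ι {y | ENNReal.ofReal (R ^ (2 * n)) ≤ ENNReal.ofReal (‖L y‖ ^ (2 * n))} := by
          gcongr
      _ ≤ _ := hmark.trans hmom
  have h2 : 2 * gaussMeasure ι Bᶜ ≤ G :=
    (ENNReal.mul_le_mul_iff_right (by simpa using hΛ0) ENNReal.ofReal_ne_top).1 h1
  have h3 : gaussMeasure ι B + gaussMeasure ι Bᶜ = G := measure_add_measure_compl hBm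
  have h4 : G + G ≤ 2 * gaussMeasure ι B + G := by
    calc G + G = 2 * gaussMeasure ι B + 2 * gaussMeasure ι Bᶜ := by rw [← h3]; ring
      _ ≤ _ := by gcongr
  exact (ENNReal.add_le_add_iff_right gaussMeasure_univ_ne_top).1 h4

/-- The constant in the entropy bound for multipliers from `ℓ_2` to `L_∞`. -/
def sudakovConst (d : ℕ) : ℝ := 4 * √(256 * 16 ^ d)

theorem norm_trigPoly_le {d : ℕ} (E : Finset (Fin d → ℤ)) (c : (Fin d → ℤ) → ℂ) :
    ‖trigPoly E c‖ ≤ ∑ k ∈ E, ‖c k‖ := by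
  refine (ContinuousMap.norm_le _ (by positivity)).2 fun x => ?_
  rw [trigPoly_apply]
  refine (norm_sum_le _ _).trans (le_of_eq ?_)
  simp [norm_trigChar_apply]

/-- Entropy of a multiplier from the unit ball of `ℓ_2` to `L_∞`. -/
theorem covers_multiplier_l2 {d n : ℕ} (hn : 1 ≤ n) (M : (Fin d → ℤ) → ℝ) {N : ℝ} (hN : 0 < N)
    (hM : ∑ k ∈ freqBox d (2 ^ n), M k ^ 2 ≤ N) (b : ℕ) :
    Covers {c : (Fin d → ℤ) → ℂ | ∑ k ∈ freqBox d (2 ^ n), ‖c k‖ ^ 2 ≤ 1}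
      (fun c => trigPoly (freqBox d (2 ^ n)) fun k => M k * c k) b
      (sudakovConst d * √(n * N / (b + 1))) := by
  set E := freqBox d (2 ^ n) with hE
  have hn1 : (1 : ℝ) ≤ n := by exact_mod_cast hn
  have hb0 : (0 : ℝ) < b + 1 := by positivity
  rcases lt_or_ge b 2 with hb | hb
  · refine Covers.of_norm_le fun c hc => ?_
    have hc1 : ∑ k ∈ E, ‖c k‖ ^ 2 ≤ 1 := hc
    have h1 : ‖trigPoly E fun k => M k * c k‖ ≤ √N := by
      refine (norm_trigPoly_le _ _).trans (le_sqrt_of_sq_le ?_)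
      calc (∑ k ∈ E, ‖(M k : ℂ) * c k‖) ^ 2 = (∑ k ∈ E, |M k| * ‖c k‖) ^ 2 := by
            simp
        _ ≤ (∑ k ∈ E, |M k| ^ 2) * ∑ k ∈ E, ‖c k‖ ^ 2 := Finset.sum_mul_sq_le_sq_mul_sq _ _ _
        _ ≤ N * 1 := by
            simp only [sq_abs]
            gcongr
        _ = N := mul_one N
    refine h1.trans ?_
    have hb2 : (b : ℝ) + 1 ≤ 2 := by
      have : b + 1 ≤ 2 := hb
      exact_mod_cast this
    rw [sudakovConst, mul_assoc, ← sqrt_mul (by positivity)]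
    have h2 : √N ≤ √(256 * 16 ^ d * (n * N / (b + 1))) := by
      refine sqrt_le_sqrt ?_
      have h3 : (1 : ℝ) ≤ 16 ^ d := one_le_pow₀ (by norm_num)
      have h4 : N / 2 ≤ n * N / (b + 1) := by
        rw [div_le_div_iff₀ (by norm_num) hb0]
        nlinarith
      nlinarith
    linarith [sqrt_nonneg (256 * 16 ^ d * (n * N / (b + 1)))]
  · let v : E × Bool → C(Torus d, ℂ) := fun i =>
      ((M i.1 : ℂ) * if i.2 then Complex.I else 1) • trigChar (i.1 : Fin d → ℤ)
    let L : (E × Bool → ℝ) →L[ℝ] C(Torus d, ℂ) :=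
      ∑ i, (ContinuousLinearMap.proj (R := ℝ) (φ := fun _ : E × Bool => ℝ) i).smulRight (v i)
    have hL : ∀ y, L y = ∑ i, (y i : ℂ) • v i := fun y => by
      simp [L]
    have hvN : ∀ x, ∑ i, ‖v i x‖ ^ 2 ≤ 2 * N := by
      intro x
      have h1 : ∀ i, ‖v i x‖ ^ 2 = M i.1 ^ 2 := by
        rintro ⟨k, a⟩
        cases a <;> simp [v, norm_trigChar_apply]
      simp only [h1, Fintype.sum_prod_type, Finset.sum_const, Finset.card_univ, Fintype.card_bool]
      rw [← Finset.smul_sum, Finset.sum_coe_sort E fun k => M k ^ 2, nsmul_eq_mul]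
      push_cast
      linarith
    have hG := gaussMeasure_univ_le_of_polySpace hn v
      (fun i => Submodule.smul_mem _ _ (trigChar_mem_polySpace i.1.2)) hN hvN L hL
    set t := √(b + 1) / 2 with ht
    have ht0 : 0 < t := by positivity
    have htb : 2 * exp (t ^ 2 / 2) ≤ 2 ^ b := by
      obtain ⟨b', rfl⟩ : ∃ b', b = b' + 1 := ⟨b - 1, by omega⟩
      have hb1 : (1 : ℝ) ≤ b' := by
        have : 1 ≤ b' := by omega
        exact_mod_cast this
      rw [pow_succ (2 : ℝ), mul_comm ((2 : ℝ) ^ b') 2]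
      refine mul_le_mul_of_nonneg_left ?_ (by norm_num)
      have h1 : t ^ 2 / 2 ≤ b' * (1 / 2) := by
        rw [ht, div_pow, sq_sqrt (by positivity)]
        push_cast
        linarith
      have h2 : exp (1 / 2) ≤ 2 := by
        have h3 : exp (1 / 2) ^ 2 = exp 1 := by
          rw [← exp_nat_mul]; norm_num
        have h4 := exp_one_lt_d9
        have h5 := exp_pos (1 / 2)
        nlinarith
      calc _ ≤ exp (b' * (1 / 2)) := exp_le_exp.2 h1
        _ = exp (1 / 2) ^ b' := exp_nat_mul _ _
        _ ≤ 2 ^ b' := by gcongr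
    have hcov := covers_of_gaussMeasure L ht0 hG htb
    have hrad : 2 * √(256 * 16 ^ d * (n * N)) / t = sudakovConst d * √(n * N / (b + 1)) := by
      rw [sudakovConst, sqrt_mul (by positivity), sqrt_div (by positivity), ht]
      field_simp
      norm_num
    rw [hrad] at hcov
    have hcomp := hcov.comp
      (P' := {c : (Fin d → ℤ) → ℂ | ∑ k ∈ E, ‖c k‖ ^ 2 ≤ 1})
      (fun c i => if i.2 then (c i.1).im else (c i.1).re) ?_
    · convert hcomp using 2 with c
      rw [hL, Fintype.sum_prod_type, trigPoly, ← Finset.sum_coe_sort E]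
      refine Finset.sum_congr rfl fun k _ => ?_
      simp only [Fintype.sum_bool, v, smul_smul, ← add_smul]
      congr 1
      simp only [if_true, Bool.false_eq_true, if_false, mul_one]
      linear_combination (-(M k : ℂ)) * Complex.re_add_im (c k)
    · intro c hc
      have hc1 : ∑ k ∈ E, ‖c k‖ ^ 2 ≤ 1 := hc
      change ∑ i : E × Bool, _ ≤ (1 : ℝ)
      rw [Fintype.sum_prod_type]
      refine le_trans (le_of_eq ?_) hc1
      rw [← Finset.sum_coe_sort E]
      refine Finset.sum_congr rfl fun k _ => ?_
      rw [← Complex.normSq_eq_norm_sq, Complex.normSq_apply]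
      simp
      ring

theorem Covers.const_smul {α X : Type*} [NormedAddCommGroup X] [NormedSpace ℂ X] {P : Set α}
    {T : α → X} {b : ℕ} {ε : ℝ} (h : Covers P T b ε) (r : ℂ) :
    Covers P (fun x => r • T x) b (‖r‖ * ε) := by
  obtain ⟨S, hS, hT⟩ := h
  refine ⟨S.image (r • ·), Finset.card_image_le.trans hS, fun x hx => ?_⟩
  obtain ⟨y, hy, hε⟩ := hT x hx
  refine ⟨r • y, Finset.mem_image_of_mem _ hy, ?_⟩
  rw [← smul_sub, norm_smul]
  gcongr

theorem integral_conj_trigChar_mul_eq {d : ℕ} (f : Torus d → ℂ) (k : Fin d → ℤ) :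
    ∫ x, conj (trigChar k x) * f x = (((2 * π) ^ d : ℝ) : ℂ) * fCoeff f k := by
  rw [fCoeff, Complex.real_smul, ← mul_assoc, ← Complex.ofReal_mul,
    mul_inv_cancel₀ (by positivity), Complex.ofReal_one, one_mul]

theorem integrable_conj_trigChar_mul {d : ℕ} {f : Torus d → ℂ} (hf : Integrable f)
    (k : Fin d → ℤ) : Integrable fun x => conj (trigChar k x) * f x := by
  refine hf.bdd_mul (c := 1) (by fun_prop) (ae_of_all _ fun x => ?_)
  simp [norm_trigChar_apply]

theorem fCoeff_add {d : ℕ} {f g : Torus d → ℂ} (hf : Integrable f) (hg : Integrable g)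
    (k : Fin d → ℤ) : fCoeff (f + g) k = fCoeff f k + fCoeff g k := by
  simp only [fCoeff, Pi.add_apply, mul_add]
  rw [integral_add (integrable_conj_trigChar_mul hf k) (integrable_conj_trigChar_mul hg k),
    smul_add]

/-- Bessel's inequality. -/
theorem sum_norm_sq_fCoeff_le {d : ℕ} {f : Torus d → ℂ} (hf : MemLp f 2)
    (E : Finset (Fin d → ℤ)) :
    (2 * π) ^ d * ∑ k ∈ E, ‖fCoeff f k‖ ^ 2 ≤ ∫ x, ‖f x‖ ^ 2 := by
  have hf1 : Integrable f := hf.integrable (by norm_num)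
  set g := trigPoly E (fCoeff f) with hg
  have hint : ∀ k, Integrable fun x => conj (fCoeff f k) * (conj (trigChar k x) * f x) :=
    fun k => (integrable_conj_trigChar_mul hf1 k).const_mul _
  have hgf : ∀ x, conj (g x) * f x =
      ∑ k ∈ E, conj (fCoeff f k) * (conj (trigChar k x) * f x) := fun x => by
    rw [hg, trigPoly_apply, map_sum, Finset.sum_mul]
    simp only [map_mul, mul_assoc]
  have hgfi : Integrable fun x => conj (g x) * f x := by
    simp_rw [hgf]
    exact integrable_finsetSum _ fun k _ => hint k
  have hcross : ∫ x, conj (g x) * f x =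
      (((2 * π) ^ d * ∑ k ∈ E, ‖fCoeff f k‖ ^ 2 : ℝ) : ℂ) := by
    simp_rw [hgf]
    rw [integral_finsetSum _ fun k _ => hint k, Finset.mul_sum, Complex.ofReal_sum]
    refine Finset.sum_congr rfl fun k _ => ?_
    rw [integral_const_mul, integral_conj_trigChar_mul_eq, Complex.ofReal_mul, Complex.ofReal_pow ‖_‖,
      ← Complex.conj_mul']
    ring
  have hre : ∫ x, (conj (g x) * f x).re = (2 * π) ^ d * ∑ k ∈ E, ‖fCoeff f k‖ ^ 2 := by
    have := integral_re hgfi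
    simp only [RCLike.re_eq_complex_re] at this
    rw [this, hcross, Complex.ofReal_re]
  have hf2 : Integrable fun x => ‖f x‖ ^ 2 := hf.integrable_norm_pow (by norm_num)
  have hg2 : Integrable fun x => ‖g x‖ ^ 2 :=
    ContinuousMap.integrable_of_compactSpace (f := fun x => ‖g x‖ ^ 2) (by fun_prop)
  have hpt : ∀ x, 2 * (conj (g x) * f x).re ≤ ‖f x‖ ^ 2 + ‖g x‖ ^ 2 := fun x => by
    have h1 : (conj (g x) * f x).re ≤ ‖g x‖ * ‖f x‖ := by
      refine (Complex.re_le_norm _).trans ?_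
      simp
    nlinarith [sq_nonneg (‖f x‖ - ‖g x‖)]
  have h := integral_mono (hgfi.re.const_mul 2) (hf2.add hg2) hpt
  simp only [RCLike.re_eq_complex_re] at h
  rw [integral_const_mul, hre, integral_add' hf2 hg2, integral_norm_sq_trigPoly] at h
  linarith

/-- Fourier multipliers as convolution operators. -/
theorem trigPoly_multiplier_apply {d : ℕ} (E : Finset (Fin d → ℤ)) (M : (Fin d → ℤ) → ℂ)
    {f : Torus d → ℂ} (hf : Integrable f) (x : Torus d) :
    trigPoly E (fun k => M k * fCoeff f k) x =
      (((2 * π) ^ d)⁻¹ : ℝ) * ∫ y, trigPoly E M (x - y) * f y := by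
  have h : ∀ y, trigPoly E M (x - y) * f y =
      ∑ k ∈ E, (M k * trigChar k x) * (conj (trigChar k y) * f y) := fun y => by
    rw [trigPoly_apply, Finset.sum_mul]
    refine Finset.sum_congr rfl fun k _ => ?_
    rw [trigChar_sub_apply]
    ring
  simp_rw [h]
  rw [integral_finsetSum _ fun k _ => (integrable_conj_trigChar_mul hf k).const_mul _,
    trigPoly_apply, Finset.mul_sum]
  refine Finset.sum_congr rfl fun k _ => ?_
  rw [integral_const_mul, integral_conj_trigChar_mul_eq]
  have : ((2 * π) ^ d : ℂ) ≠ 0 := by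
    have : (π : ℂ) ≠ 0 := by exact_mod_cast pi_ne_zero
    simp [this]
  push_cast
  field_simp

theorem norm_trigPoly_neg {d : ℕ} (E : Finset (Fin d → ℤ)) (M : (Fin d → ℤ) → ℝ) (x y : Torus d) :
    ‖trigPoly E (fun k => (M k : ℂ)) (x - y)‖ = ‖trigPoly E (fun k => (M k : ℂ)) (y - x)‖ := by
  rw [← RCLike.norm_conj]
  congr 1
  simp only [trigPoly_apply, map_sum, map_mul, trigChar_sub_apply, Complex.conj_ofReal,
    Complex.conj_conj, mul_comm (conj _)]

/-- Multipliers with integrable kernel on bounded functions. -/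
theorem norm_trigPoly_multiplier_le {d : ℕ} (E : Finset (Fin d → ℤ)) (M : (Fin d → ℤ) → ℝ)
    {A : ℝ} (hK : ∫ x : Torus d, ‖trigPoly E (fun k => (M k : ℂ)) x‖ ≤ (2 * π) ^ d * A)
    {f : Torus d → ℂ} (hf : Integrable f) {r : ℝ} (hr : 0 ≤ r) (hfr : ∀ x, ‖f x‖ ≤ r) :
    ‖trigPoly E fun k => M k * fCoeff f k‖ ≤ A * r := by
  set K := trigPoly E (fun k => (M k : ℂ)) with hKdef
  have hA : 0 ≤ A := by
    have h0 : 0 ≤ ∫ x : Torus d, ‖K x‖ := integral_nonneg fun x => norm_nonneg _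
    exact nonneg_of_mul_nonneg_right (h0.trans hK) (by positivity)
  refine (ContinuousMap.norm_le _ (by positivity)).2 fun x => ?_
  have hKi : Integrable fun y => ‖K (y - x)‖ :=
    ContinuousMap.integrable_of_compactSpace (f := fun y => ‖K (y - x)‖) (by fun_prop)
  rw [trigPoly_multiplier_apply E _ hf, norm_mul]
  have h1 : ‖∫ y, K (x - y) * f y‖ ≤ ∫ y, ‖K (y - x)‖ * r := by
    refine norm_integral_le_of_norm_le (hKi.mul_const r) (ae_of_all _ fun y => ?_)
    rw [norm_mul, hKdef, norm_trigPoly_neg]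
    gcongr
    exact hfr y
  rw [integral_mul_const, integral_sub_right_eq_self (fun y => ‖K y‖) x] at h1
  rw [Complex.norm_real, norm_of_nonneg (by positivity)]
  calc _ ≤ ((2 * π) ^ d)⁻¹ * (((2 * π) ^ d * A) * r) := by
        refine mul_le_mul_of_nonneg_left (h1.trans ?_) (by positivity)
        gcongr
    _ = A * r := by
      field_simp

/-- Entropy of a Fourier multiplier with integrable kernel from `L_p` to `L_∞`, `2 ≤ p`. -/
theorem covers_multiplier_Lp {d n : ℕ} (hn : 1 ≤ n) {p : ℝ} (hp : 2 ≤ p)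
    (M : (Fin d → ℤ) → ℝ) (hM0 : ∀ k, 0 ≤ M k) (hM1 : ∀ k, M k ≤ 1) {N : ℝ} (hN : 0 < N)
    (hMN : ∑ k ∈ freqBox d (2 ^ n), M k ≤ N) {A : ℝ} (hA : 0 < A)
    (hK : ∫ x : Torus d, ‖trigPoly (freqBox d (2 ^ n)) (fun k => (M k : ℂ)) x‖ ≤ (2 * π) ^ d * A)
    (b : ℕ) :
    Covers {f : Lp ℂ (ENNReal.ofReal p) (volume : Measure (Torus d)) | ‖f‖ ≤ 1}
      (fun f => trigPoly (freqBox d (2 ^ n)) fun k => M k * fCoeff f k) b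
      ((sudakovConst d + 1) * (A ^ (1 - 2 / p) * (n * N / (b + 1)) ^ (1 / p))) := by
  set E := freqBox d (2 ^ n) with hE
  have hp0 : 0 < p := by linarith
  have hn0 : (0 : ℝ) < n := by exact_mod_cast hn
  set Y : ℝ := n * N / (b + 1) with hY
  have hY0 : 0 < Y := by positivity
  set r : ℝ := (Y / A ^ 2) ^ (1 / p) with hr
  have hr0 : 0 < r := by positivity
  have hArY : A ^ (1 - 2 / p) * Y ^ (1 / p) = A * r := by
    rw [hr, div_rpow hY0.le (by positivity), ← rpow_natCast, ← rpow_mul hA.le, rpow_sub hA, rpow_one]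
    push_cast
    rw [mul_one_div]
    ring
  set μ : ℝ := r ^ (1 - p / 2) with hμ
  have hμ0 : 0 < μ := by positivity
  have hμ2 : μ ^ 2 = r ^ (2 - p) := by
    rw [hμ, ← rpow_natCast, ← rpow_mul hr0.le]
    congr 1
    push_cast
    ring
  have hμY : μ * √Y = A * r := by
    have h1 : Y = A ^ 2 * r ^ p := by
      rw [hr, ← rpow_mul (by positivity), one_div, inv_mul_cancel₀ hp0.ne', rpow_one]
      field_simp
    rw [h1, sqrt_mul (by positivity), sqrt_sq hA.le, hμ, sqrt_eq_rpow, ← rpow_mul hr0.le,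
      mul_left_comm, ← rpow_add hr0]
    ring_nf
    rw [rpow_one]
  rw [hArY]
  have hMsq : ∑ k ∈ E, M k ^ 2 ≤ N := by
    refine (Finset.sum_le_sum fun k _ => ?_).trans hMN
    nlinarith [hM0 k, hM1 k]
  have hl2 := covers_multiplier_l2 hn M hN hMsq b
  let f₀ : Lp ℂ (ENNReal.ofReal p) (volume : Measure (Torus d)) → Torus d → ℂ :=
    fun f => {x | r < ‖f x‖}.indicator f
  let f₁ : Lp ℂ (ENNReal.ofReal p) (volume : Measure (Torus d)) → Torus d → ℂ :=
    fun f => {x | r < ‖f x‖}ᶜ.indicator f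
  have hset : ∀ f : Lp ℂ (ENNReal.ofReal p) (volume : Measure (Torus d)),
      MeasurableSet {x | r < ‖f x‖} := fun f =>
    measurableSet_lt measurable_const (Lp.stronglyMeasurable f).measurable.norm
  have hL2 : ∀ f : Lp ℂ (ENNReal.ofReal p) (volume : Measure (Torus d)), MemLp f 2 := fun f =>
    (Lp.memLp f).mono_exponent (by
      rw [← ENNReal.ofReal_ofNat]
      exact ENNReal.ofReal_le_ofReal hp)
  have hf₀ : ∀ f, MemLp (f₀ f) 2 := fun f => (hL2 f).indicator (hset f)
  have hf₁ : ∀ f, MemLp (f₁ f) 2 := fun f => (hL2 f).indicator (hset f).compl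
  have hcov₀ := (hl2.comp
    (P' := {f : Lp ℂ (ENNReal.ofReal p) (volume : Measure (Torus d)) | ‖f‖ ≤ 1})
    (fun f k => (μ : ℂ)⁻¹ * fCoeff (f₀ f) k) ?_).const_smul (μ : ℂ)
  · have hcov₁ : Covers {f : Lp ℂ (ENNReal.ofReal p) (volume : Measure (Torus d)) | ‖f‖ ≤ 1}
        (fun f => trigPoly E fun k => M k * fCoeff (f₁ f) k) 0 (A * r) := by
      refine Covers.of_norm_le fun f _ => ?_
      refine norm_trigPoly_multiplier_le E M hK ((hf₁ f).integrable (by norm_num)) hr0.le fun x => ?_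
      by_cases hx : r < ‖f x‖
      · simp [f₁, hx, hr0.le]
      · simpa [f₁, hx] using not_lt.1 hx
    convert hcov₀.add hcov₁ using 1
    · funext f
      have hsum : (f : Torus d → ℂ) = f₀ f + f₁ f := (Set.indicator_self_add_compl _ _).symm
      simp only [trigPoly]
      rw [Finset.smul_sum, ← Finset.sum_add_distrib]
      refine Finset.sum_congr rfl fun k _ => ?_
      rw [smul_smul, ← add_smul]
      congr 1
      conv_lhs => rw [hsum]
      rw [fCoeff_add ((hf₀ f).integrable (by norm_num)) ((hf₁ f).integrable (by norm_num))]
      have : (μ : ℂ) ≠ 0 := by exact_mod_cast hμ0.ne'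
      field_simp
    · rfl
    · rw [Complex.norm_real, norm_of_nonneg hμ0.le, mul_left_comm μ, hμY]
      ring
  · intro f hf
    have hf1 : ‖f‖ ≤ 1 := hf
    have hpi : Integrable fun x => ‖f x‖ ^ p := by
      have := (Lp.memLp f).integrable_norm_rpow (by simpa using hp0) ENNReal.ofReal_ne_top
      rwa [ENNReal.toReal_ofReal hp0.le] at this
    have hfp : ∫ x, ‖f x‖ ^ p ≤ 1 := by
      have h1 := (Lp.memLp f).eLpNorm_eq_integral_rpow_norm (by simpa using hp0)
        ENNReal.ofReal_ne_top
      rw [ENNReal.toReal_ofReal hp0.le] at h1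
      have h0 : 0 ≤ ∫ x, ‖f x‖ ^ p := integral_nonneg fun x => by positivity
      rw [Lp.norm_def, h1, ENNReal.toReal_ofReal (by positivity)] at hf1
      by_contra! h
      exact absurd hf1 (not_le.2 (Real.one_lt_rpow h (by positivity)))
    have hpt : ∀ x, ‖f₀ f x‖ ^ 2 ≤ r ^ (2 - p) * ‖f x‖ ^ p := fun x => by
      by_cases hx : r < ‖f x‖
      · have hx0 : 0 < ‖f x‖ := hr0.trans hx
        have h1 : ‖f x‖ ^ (2 - p) ≤ r ^ (2 - p) :=
          rpow_le_rpow_of_nonpos hr0 hx.le (by linarith)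
        have h2 : ‖f x‖ ^ 2 = ‖f x‖ ^ (2 - p) * ‖f x‖ ^ p := by
          rw [← rpow_add hx0, ← rpow_natCast]
          congr 1
          push_cast
          ring
        have h3 : f₀ f x = f x := by simp [f₀, hx]
        rw [h3, h2]
        gcongr
      · have h3 : f₀ f x = 0 := by simp [f₀, hx]
        rw [h3]
        have : 0 ≤ r ^ (2 - p) * ‖f x‖ ^ p := by positivity
        simpa using this
    have h2 : ∫ x, ‖f₀ f x‖ ^ 2 ≤ r ^ (2 - p) := by
      calc _ ≤ ∫ x, r ^ (2 - p) * ‖f x‖ ^ p :=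
            integral_mono ((hf₀ f).integrable_norm_pow (by norm_num)) (hpi.const_mul _) hpt
        _ = r ^ (2 - p) * ∫ x, ‖f x‖ ^ p := integral_const_mul _ _
        _ ≤ r ^ (2 - p) * 1 := by gcongr
        _ = _ := mul_one _
    have h3 := (sum_norm_sq_fCoeff_le (hf₀ f) E).trans h2
    have h4 : (1 : ℝ) ≤ (2 * π) ^ d := one_le_pow₀ (by linarith [pi_gt_three])
    have h5 : 0 ≤ ∑ k ∈ E, ‖fCoeff (f₀ f) k‖ ^ 2 := Finset.sum_nonneg fun k _ => by positivity
    change ∑ k ∈ E, ‖(μ : ℂ)⁻¹ * fCoeff (f₀ f) k‖ ^ 2 ≤ 1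
    simp only [norm_mul, norm_inv, Complex.norm_real, norm_of_nonneg hμ0.le, mul_pow]
    rw [← Finset.mul_sum, inv_pow, hμ2, inv_mul_le_iff₀ (rpow_pos_of_pos hr0 _), mul_one]
    nlinarith

/-- The hat function of height `1` and width `2 L` centred at `a`. -/
def tent (L : ℕ) (a k : ℤ) : ℝ := (max 0 ((L : ℤ) - |k - a|) : ℤ) / (L : ℝ)

theorem tent_eq_sum (L : ℕ) (a k : ℤ) :
    tent L a k = ∑ i ∈ Finset.Ico (0 : ℤ) L, ∑ i' ∈ Finset.Ico (0 : ℤ) L,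
      if a + i - i' = k then (L : ℝ)⁻¹ else 0 := by
  have h1 : ∀ i ∈ Finset.Ico (0 : ℤ) L, (∑ i' ∈ Finset.Ico (0 : ℤ) L,
      if a + i - i' = k then (L : ℝ)⁻¹ else 0) =
      if i ∈ Finset.Ico (k - a) (L + (k - a)) then (L : ℝ)⁻¹ else 0 := by
    intro i _
    have h2 : ∀ i', (a + i - i' = k) = (i' = a + i - k) := fun i' =>
      propext ⟨fun h => by omega, fun h => by omega⟩
    simp only [h2, Finset.sum_ite_eq']
    congr 1
    simp only [Finset.mem_Ico, eq_iff_iff]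
    constructor <;> intro h <;> omega
  rw [Finset.sum_congr rfl h1, ← Finset.sum_filter, Finset.sum_const, nsmul_eq_mul, tent,
    div_eq_mul_inv, Finset.filter_mem_eq_inter, Finset.Ico_inter_Ico, Int.card_Ico]
  congr 1
  have h3 : (max 0 ((L : ℤ) - |k - a|) : ℤ) =
      (((min (L : ℤ) (L + (k - a)) - max 0 (k - a)).toNat : ℕ) : ℤ) := by
    rw [Int.toNat_eq_max]
    rcases abs_cases (k - a) with h | h <;> omega
  rw [h3]
  exact Int.cast_natCast _

theorem tent_nonneg (L : ℕ) (a k : ℤ) : 0 ≤ tent L a k := by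
  unfold tent
  positivity

/-- A nonnegative multiplier on `ℤ` of mass at most `N`, supported on `[-W, W]` for the purposes of
summation, whose convolution kernel has normalized `L_1` norm at most one. -/
def IsFejerAtom (W : ℕ) (N : ℝ) (φ : ℤ → ℝ) : Prop :=
  (∀ k, 0 ≤ φ k) ∧ ∑ k ∈ Finset.Icc (-(W : ℤ)) W, φ k ≤ N ∧
    ∫ x : AddCircle (2 * π), ‖∑ k ∈ Finset.Icc (-(W : ℤ)) W, (φ k : ℂ) * fourier k x‖ ≤ 2 * π

theorem isFejerAtom_zero (W : ℕ) {N : ℝ} (hN : 0 ≤ N) : IsFejerAtom W N fun _ => 0 :=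
  ⟨fun _ => le_rfl, by simpa using hN, by simpa using two_pi_pos.le⟩

theorem IsFejerAtom.mono {W : ℕ} {N N' : ℝ} {φ : ℤ → ℝ} (h : IsFejerAtom W N φ) (hN : N ≤ N') :
    IsFejerAtom W N' φ :=
  ⟨h.1, h.2.1.trans hN, h.2.2⟩

theorem IsFejerAtom.const_mul {W : ℕ} {N : ℝ} {φ : ℤ → ℝ} (h : IsFejerAtom W N φ) {c : ℝ} (hc0 : 0 ≤ c)
    (hc1 : c ≤ 1) : IsFejerAtom W N fun k => c * φ k := by
  obtain ⟨h0, hs, hk⟩ := h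
  refine ⟨fun k => mul_nonneg hc0 (h0 k), ?_, ?_⟩
  · rw [← Finset.mul_sum]
    have := Finset.sum_nonneg fun k (_ : k ∈ Finset.Icc (-(W : ℤ)) W) => h0 k
    nlinarith
  · have h1 : ∀ x : AddCircle (2 * π),
        ‖∑ k ∈ Finset.Icc (-(W : ℤ)) W, ((c * φ k : ℝ) : ℂ) * fourier k x‖ =
          c * ‖∑ k ∈ Finset.Icc (-(W : ℤ)) W, (φ k : ℂ) * fourier k x‖ := fun x => by
      simp only [Complex.ofReal_mul, mul_assoc]
      rw [← Finset.mul_sum, norm_mul, Complex.norm_real, norm_of_nonneg hc0]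
    simp_rw [h1]
    rw [integral_const_mul]
    have : 0 ≤ ∫ x : AddCircle (2 * π),
        ‖∑ k ∈ Finset.Icc (-(W : ℤ)) W, (φ k : ℂ) * fourier k x‖ :=
      integral_nonneg fun x => norm_nonneg _
    nlinarith

/-- Fejér kernels have normalized `L_1` norm one. -/
theorem isFejerAtom_tent {W L : ℕ} (hL : 0 < L) {a : ℤ} (h1 : -(W : ℤ) ≤ a - L) (h2 : a + L ≤ W) :
    IsFejerAtom W L (tent L a) := by
  have hL0 : (L : ℝ) ≠ 0 := by positivity
  have hmem : ∀ i ∈ Finset.Ico (0 : ℤ) L, ∀ i' ∈ Finset.Ico (0 : ℤ) L,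
      a + i - i' ∈ Finset.Icc (-(W : ℤ)) W := by
    intro i hi i' hi'
    simp only [Finset.mem_Ico, Finset.mem_Icc] at *
    omega
  refine ⟨tent_nonneg L a, le_of_eq ?_, le_of_eq ?_⟩
  · simp_rw [tent_eq_sum]
    rw [Finset.sum_comm]
    have : ∀ i ∈ Finset.Ico (0 : ℤ) L, (∑ k ∈ Finset.Icc (-(W : ℤ)) W,
        ∑ i' ∈ Finset.Ico (0 : ℤ) L, if a + i - i' = k then (L : ℝ)⁻¹ else 0) = 1 := by
      intro i hi
      rw [Finset.sum_comm, Finset.sum_congr rfl fun i' hi' => by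
        rw [Finset.sum_ite_eq, if_pos (hmem i hi i' hi')]]
      simp [hL0]
    rw [Finset.sum_congr rfl this]
    simp
  · have hker : ∀ x : AddCircle (2 * π),
        ‖∑ k ∈ Finset.Icc (-(W : ℤ)) W, (tent L a k : ℂ) * fourier k x‖ =
          (L : ℝ)⁻¹ * ‖∑ i ∈ Finset.Ico (0 : ℤ) L, (1 : ℂ) * fourier i x‖ ^ 2 := fun x => by
      have h3 : ∑ k ∈ Finset.Icc (-(W : ℤ)) W, (tent L a k : ℂ) * fourier k x =
          (L : ℂ)⁻¹ * (fourier a x * ((∑ i ∈ Finset.Ico (0 : ℤ) L, (1 : ℂ) * fourier i x) *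
            conj (∑ i ∈ Finset.Ico (0 : ℤ) L, (1 : ℂ) * fourier i x))) := by
        simp_rw [tent_eq_sum, Complex.ofReal_sum, Finset.sum_mul]
        rw [Finset.sum_comm, Finset.mul_sum, Finset.mul_sum]
        refine Finset.sum_congr rfl fun i hi => ?_
        rw [Finset.sum_comm, map_sum, Finset.mul_sum, Finset.mul_sum, Finset.mul_sum]
        refine Finset.sum_congr rfl fun i' hi' => ?_
        rw [Finset.sum_congr rfl (g := fun k => if a + i - i' = k then
          (L : ℂ)⁻¹ * fourier k x else 0) fun k _ => by split_ifs <;> simp, Finset.sum_ite_eq,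
          if_pos (hmem i hi i' hi'), sub_eq_add_neg, fourier_add, fourier_add, fourier_neg]
        simp only [one_mul]
        ring
      rw [h3, norm_mul, norm_mul, norm_mul, RCLike.norm_conj, norm_inv, Complex.norm_natCast,
        show ‖(fourier a x : ℂ)‖ = 1 from Circle.norm_coe _, one_mul, ← sq]
    simp_rw [hker]
    rw [integral_const_mul, integral_norm_sq_sum (fun (i : ℤ) x => (fourier i x : ℂ))
      (fun k l => ContinuousMap.integrable_of_compactSpace (by fun_prop))
      integral_conj_fourier_mul (Finset.Ico (0 : ℤ) L) fun _ => 1]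
    simp
    field_simp

/-- Decompositions into `K` families of atoms of geometrically decreasing mass. -/
def AtomicDecomp (n s K : ℕ) (χ : ℤ → ℝ) : Prop :=
  ∃ φ : ℕ → Fin K → ℤ → ℝ, (∀ r c, IsFejerAtom (2 ^ n) (2 ^ s / 2 ^ r) (φ r c)) ∧
    ∀ k, χ k = ∑ r ∈ Finset.range (n + 1), ∑ c, φ r c k

theorem AtomicDecomp.add {n s K K' : ℕ} {χ χ' : ℤ → ℝ} (h : AtomicDecomp n s K χ)
    (h' : AtomicDecomp n s K' χ') : AtomicDecomp n s (K + K') fun k => χ k + χ' k := by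
  obtain ⟨φ, hφ, hs⟩ := h
  obtain ⟨φ', hφ', hs'⟩ := h'
  refine ⟨fun r => Fin.append (φ r) (φ' r), fun r c => ?_, fun k => ?_⟩
  · refine Fin.addCases (fun i => ?_) (fun i => ?_) c
    · simpa using hφ r i
    · simpa using hφ' r i
  · dsimp only
    rw [hs, hs', ← Finset.sum_add_distrib]
    simp [Fin.sum_univ_add]

theorem AtomicDecomp.pad {n s K : ℕ} {χ : ℤ → ℝ} (h : AtomicDecomp n s K χ) (K' : ℕ) :
    AtomicDecomp n s (K + K') χ := by
  have h0 : AtomicDecomp n s K' fun _ => 0 :=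
    ⟨fun _ _ _ => 0, fun _ _ => isFejerAtom_zero _ (by positivity), fun _ => by simp⟩
  simpa using h.add h0

theorem atomicDecomp_sum {n s : ℕ} {ψ : ℕ → ℤ → ℝ}
    (h : ∀ r, IsFejerAtom (2 ^ n) (2 ^ s / 2 ^ r) (ψ r)) :
    AtomicDecomp n s 1 fun k => ∑ r ∈ Finset.range (n + 1), ψ r k :=
  ⟨fun r _ => ψ r, fun r _ => h r, fun k => by simp⟩

theorem atomicDecomp_tents {n s : ℕ} (hs : s ≤ n) (a : ℕ → ℤ) {c : ℝ}
    (hc0 : 0 ≤ c) (hc1 : c ≤ 1) (I : Finset ℕ) (hI : ∀ j ∈ I, j ≤ s)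
    (h1 : ∀ j ∈ I, -((2 ^ n : ℕ) : ℤ) ≤ a j - (2 ^ j : ℕ))
    (h2 : ∀ j ∈ I, a j + (2 ^ j : ℕ) ≤ (2 ^ n : ℕ)) :
    AtomicDecomp n s 1 fun k => ∑ j ∈ I, c * tent (2 ^ j) (a j) k := by
  have h := atomicDecomp_sum (n := n) (s := s)
    (ψ := fun r k => if r ≤ s ∧ s - r ∈ I then c * tent (2 ^ (s - r)) (a (s - r)) k else 0) ?_
  · convert h using 2 with k
    rw [← Finset.sum_filter]
    refine Finset.sum_nbij' (fun j => s - j) (fun r => s - r) ?_ ?_ ?_ ?_ ?_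
    · intro j hj
      have := hI j hj
      simp only [Finset.mem_filter, Finset.mem_range]
      refine ⟨by omega, by omega, ?_⟩
      rwa [show s - (s - j) = j by omega]
    · intro r hr
      exact (Finset.mem_filter.1 hr).2.2
    · intro j hj
      have := hI j hj
      omega
    · intro r hr
      have := (Finset.mem_filter.1 hr).2.1
      omega
    · intro j hj
      have := hI j hj
      rw [show s - (s - j) = j by omega]
  · intro r
    split_ifs with hr
    · refine (IsFejerAtom.mono (isFejerAtom_tent (by positivity) (h1 _ hr.2) (h2 _ hr.2)) ?_).const_mul
        hc0 hc1
      rw [le_div_iff₀ (by positivity)]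
      push_cast
      rw [← pow_add, Nat.sub_add_cancel hr.1]
    · exact isFejerAtom_zero _ (by positivity)

theorem half_tent_two_pow (j : ℕ) (k : ℤ) :
    1 / 2 * tent (2 ^ j) (2 ^ j) k =
      min (((max k 0 : ℤ) : ℝ) / 2 ^ j) 1 - min (((max k 0 : ℤ) : ℝ) / 2 ^ (j + 1)) 1 := by
  have h0 : (0 : ℝ) < 2 ^ j := by positivity
  unfold tent
  push_cast
  rw [pow_succ]
  generalize (2 : ℝ) ^ j = w at *
  have e : ∀ y : ℝ, min (y / w) 1 = min y w / w := fun y => by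
    rw [← min_div_div_right h0.le, div_self h0.ne']
  have e' : ∀ y : ℝ, min (y / (w * 2)) 1 = min y (w * 2) / (w * 2) := fun y => by
    rw [← min_div_div_right (by positivity), div_self (by positivity)]
  rw [e, e']
  field_simp
  generalize (k : ℝ) = t
  rcases max_cases (0 : ℝ) (w - |t - w|) with h | h <;> rcases max_cases t 0 with h' | h' <;>
    rcases abs_cases (t - w) with h'' | h'' <;>
    rcases min_cases (max t 0) w with h3 | h3 <;>
    rcases min_cases (max t 0) (2 * w) with h4 | h4 <;> rw [h.1, h3.1, h4.1] <;> linarith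

/-- Decomposition of the indicator of a dyadic interval into tents. -/
theorem indicator_Ioo_eq_tents (J : ℕ) (k : ℤ) :
    (if 0 < k ∧ k < 2 ^ (J + 1) then (1 : ℝ) else 0) =
      tent (2 ^ J) (2 ^ J) k + ∑ j ∈ Finset.range J, 1 / 2 * tent (2 ^ j) (2 ^ j) k +
        ∑ j ∈ Finset.range J, 1 / 2 * tent (2 ^ j) (2 ^ (J + 1) - 2 ^ j) k := by
  have hmir : ∀ j, tent (2 ^ j) (2 ^ (J + 1) - 2 ^ j) k = tent (2 ^ j) (2 ^ j) (2 ^ (J + 1) - k) := by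
    intro j
    unfold tent
    rw [← abs_neg]
    congr 5
    ring
  simp_rw [hmir, half_tent_two_pow]
  rw [Finset.sum_range_sub', Finset.sum_range_sub']
  have h0 : ∀ l : ℤ, min (((max l 0 : ℤ) : ℝ) / 2 ^ 0) 1 = if 0 < l then 1 else 0 := by
    intro l
    split_ifs with hl
    · rw [pow_zero, div_one, min_eq_right]
      have : 1 ≤ max l 0 := by omega
      exact_mod_cast this
    · rw [max_eq_right (by omega)]
      simp
  rw [h0, h0]
  have hw : (0 : ℝ) < 2 ^ J := by positivity
  have e : ∀ y : ℝ, min (y / 2 ^ J) 1 = min y (2 ^ J) / 2 ^ J := fun y => by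
    rw [← min_div_div_right hw.le, div_self hw.ne']
  have h1 : min (((max k 0 : ℤ) : ℝ) / 2 ^ J) 1 +
      min (((max (2 ^ (J + 1) - k) 0 : ℤ) : ℝ) / 2 ^ J) 1 = 1 + tent (2 ^ J) (2 ^ J) k := by
    rw [e, e]
    unfold tent
    push_cast
    rw [pow_succ]
    generalize (2 : ℝ) ^ J = w at *
    field_simp
    generalize (k : ℝ) = t
    rcases max_cases (0 : ℝ) (w - |t - w|) with h | h <;> rcases max_cases t 0 with h' | h' <;>
    rcases max_cases (w * 2 - t) 0 with h2 | h2 <;>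
    rcases abs_cases (t - w) with h'' | h'' <;>
    rcases min_cases (max t 0) w with h3 | h3 <;>
    rcases min_cases (max (w * 2 - t) 0) w with h4 | h4 <;> rw [h.1, h3.1, h4.1] <;> linarith
  have h2 : (if 0 < k ∧ k < 2 ^ (J + 1) then (1 : ℝ) else 0) =
      (if 0 < k then 1 else 0) + (if 0 < 2 ^ (J + 1) - k then 1 else 0) - 1 := by
    have hp : (0 : ℤ) < 2 ^ (J + 1) := by positivity
    split_ifs <;> first | (exfalso; omega) | norm_num
  rw [h2]
  linarith

theorem atomicDecomp_Ioo {n s J : ℕ} (hs : s ≤ n) (hJ : J ≤ s) {a : ℤ} (h1 : -(2 ^ n : ℤ) ≤ a)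
    (h2 : a + 2 ^ (J + 1) ≤ 2 ^ n) :
    AtomicDecomp n s 3 fun k => if a < k ∧ k < a + 2 ^ (J + 1) then 1 else 0 := by
  have key : ∀ j ≤ J, (0 : ℤ) < 2 ^ j ∧ (2 * 2 ^ j : ℤ) ≤ 2 ^ (J + 1) := fun j hj => by
    refine ⟨by positivity, ?_⟩
    rw [← pow_succ']
    exact pow_le_pow_right₀ (by norm_num) (by omega)
  have hA := atomicDecomp_tents hs (fun j => a + 2 ^ j) (c := 1) zero_le_one le_rfl {J}
    (by simpa using hJ)
    (fun j hj => by
      have := key j (by simp_all)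
      push_cast
      omega)
    (fun j hj => by
      have := key j (by simp_all)
      push_cast
      omega)
  have hB := atomicDecomp_tents hs (fun j => a + 2 ^ j) (c := 1 / 2) (by norm_num)
    (by norm_num) (Finset.range J) (fun j hj => by have := Finset.mem_range.1 hj; omega)
    (fun j hj => by
      have := key j (Finset.mem_range.1 hj).le
      push_cast
      omega)
    (fun j hj => by
      have := key j (Finset.mem_range.1 hj).le
      push_cast
      omega)
  have hC := atomicDecomp_tents hs (fun j => a + (2 ^ (J + 1) - 2 ^ j)) (c := 1 / 2)
    (by norm_num) (by norm_num) (Finset.range J)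
    (fun j hj => by have := Finset.mem_range.1 hj; omega)
    (fun j hj => by
      have := key j (Finset.mem_range.1 hj).le
      push_cast
      omega)
    (fun j hj => by
      have := key j (Finset.mem_range.1 hj).le
      push_cast
      omega)
  convert (hA.add hB).add hC using 2 with k
  have h := indicator_Ioo_eq_tents J (k - a)
  have hsh : ∀ L b, tent L (a + b) k = tent L b (k - a) := fun L b => by
    unfold tent
    rw [sub_sub]
  simp only [hsh, Finset.sum_singleton, one_mul]
  rw [← h]
  congr 1
  simp only [sub_pos, eq_iff_iff]
  constructor <;> rintro ⟨_, _⟩ <;> constructor <;> omega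

theorem atomicDecomp_singleton {n s : ℕ} (hs : s ≤ n) {a : ℤ} (h1 : -(2 ^ n : ℤ) ≤ a - 1)
    (h2 : a + 1 ≤ 2 ^ n) : AtomicDecomp n s 1 fun k => if k = a then 1 else 0 := by
  have h := atomicDecomp_tents hs (fun _ => a) (c := 1) zero_le_one le_rfl {0}
    (by simp) (fun _ hj => by rw [Finset.mem_singleton.1 hj]; push_cast; omega)
    (fun _ hj => by rw [Finset.mem_singleton.1 hj]; push_cast; omega)
  convert h using 2 with k
  simp only [Finset.sum_singleton, one_mul, tent, pow_zero]
  split_ifs with hk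
  · simp [hk]
  · rw [max_eq_left]
    · simp
    · have := Int.one_le_abs (sub_ne_zero.2 hk)
      simpa using this

/-- Indicators of dyadic balls. -/
theorem atomicDecomp_ball {n s : ℕ} (hs : s ≤ n) :
    AtomicDecomp n s 8 fun k => if |k| < 2 ^ s then 1 else 0 := by
  have hp : (2 : ℤ) ^ s ≤ 2 ^ n := pow_le_pow_right₀ (by norm_num) hs
  have h := (atomicDecomp_Ioo (n := n) hs le_rfl (a := -2 ^ s) (by omega)
    (by rw [pow_succ]; omega)).pad 5
  convert h using 3 with k
  rw [abs_lt, pow_succ]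
  constructor <;> rintro ⟨_, _⟩ <;> constructor <;> omega

/-- Indicators of dyadic blocks. -/
theorem atomicDecomp_block {n s : ℕ} (hs : s ≤ n) :
    AtomicDecomp n s 8 fun k => if (2 ^ s / 2 : ℤ) ≤ |k| ∧ |k| < 2 ^ s then 1 else 0 := by
  rcases s with _ | s
  · have h := (atomicDecomp_singleton (n := n) hs (a := 0)
      (by have : (0 : ℤ) < 2 ^ n := by positivity
          omega)
      (by have : (0 : ℤ) < 2 ^ n := by positivity
          omega)).pad 7
    convert h using 3 with k
    norm_num
  have hp : (2 : ℤ) ^ (s + 1) ≤ 2 ^ n := pow_le_pow_right₀ (by norm_num) hs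
  have hp0 : (0 : ℤ) < 2 ^ s := by positivity
  rw [pow_succ] at hp
  have hd := (atomicDecomp_singleton (n := n) hs (a := 2 ^ s) (by omega) (by omega)).add
    (atomicDecomp_singleton (n := n) hs (a := -2 ^ s) (by omega) (by omega))
  rcases s with _ | s
  · convert hd.pad 6 using 2 with k
    norm_num
    rcases abs_cases k with h | h <;> rw [h.1] <;> split_ifs <;> first | (exfalso; omega) | norm_num
  · rw [pow_succ] at hp hp0 hd
    have hi := (atomicDecomp_Ioo (n := n) hs (J := s) (by omega) (a := 2 ^ s * 2) (by omega)
      (by rw [pow_succ]; omega)).add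
      (atomicDecomp_Ioo (n := n) hs (J := s) (by omega) (a := -(2 ^ s * 2 * 2)) (by omega)
      (by rw [pow_succ]; omega))
    convert hd.add hi using 2 with k
    simp only [pow_succ]
    generalize (2 : ℤ) ^ s = w at *
    rcases abs_cases k with h | h <;> rw [h.1] <;> split_ifs <;> first | (exfalso; omega) | norm_num

theorem trigPoly_freqBox_prod_apply {d W : ℕ} (φ : Fin d → ℤ → ℝ) (x : Torus d) :
    trigPoly (freqBox d W) (fun k => ((∏ j, φ j (k j) : ℝ) : ℂ)) x =
      ∏ j, ∑ k ∈ Finset.Icc (-(W : ℤ)) W, (φ j k : ℂ) * fourier k (x j) := by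
  rw [trigPoly_apply, Finset.prod_univ_sum, freqBox]
  refine Finset.sum_congr rfl fun k _ => ?_
  rw [trigChar_apply, Finset.prod_mul_distrib, Complex.ofReal_prod]

/-- The normalized `L_1` norm of the kernel of a sum of products of atoms. -/
theorem integral_norm_trigPoly_le_card {d W : ℕ} {σ : Type*} (S : Finset σ)
    {N : σ → Fin d → ℝ} {φ : σ → Fin d → ℤ → ℝ}
    (h : ∀ s ∈ S, ∀ j, IsFejerAtom W (N s j) (φ s j)) :
    ∫ x : Torus d, ‖trigPoly (freqBox d W)
      (fun k => ((∑ s ∈ S, ∏ j, φ s j (k j) : ℝ) : ℂ)) x‖ ≤ (2 * π) ^ d * S.card := by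
  have hx : ∀ x : Torus d, trigPoly (freqBox d W)
      (fun k => ((∑ s ∈ S, ∏ j, φ s j (k j) : ℝ) : ℂ)) x =
      ∑ s ∈ S, trigPoly (freqBox d W) (fun k => ((∏ j, φ s j (k j) : ℝ) : ℂ)) x := fun x => by
    simp only [trigPoly_apply, Complex.ofReal_sum, Finset.sum_mul]
    exact Finset.sum_comm
  calc ∫ x : Torus d, ‖trigPoly (freqBox d W)
        (fun k => ((∑ s ∈ S, ∏ j, φ s j (k j) : ℝ) : ℂ)) x‖
      ≤ ∫ x : Torus d, ∑ s ∈ S,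
        ‖trigPoly (freqBox d W) (fun k => ((∏ j, φ s j (k j) : ℝ) : ℂ)) x‖ := by
        refine integral_mono (ContinuousMap.integrable_of_compactSpace (by fun_prop))
          (ContinuousMap.integrable_of_compactSpace (by fun_prop)) fun x => ?_
        dsimp only
        rw [hx]
        exact norm_sum_le _ _
    _ = ∑ s ∈ S, ∫ x : Torus d,
        ‖trigPoly (freqBox d W) (fun k => ((∏ j, φ s j (k j) : ℝ) : ℂ)) x‖ :=
        integral_finsetSum _ fun s _ => ContinuousMap.integrable_of_compactSpace (by fun_prop)
    _ ≤ ∑ s ∈ S, (2 * π) ^ d := by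
        refine Finset.sum_le_sum fun s hs => ?_
        simp_rw [trigPoly_freqBox_prod_apply, norm_prod]
        rw [integral_fintype_prod_volume_eq_prod fun j (y : AddCircle (2 * π)) =>
          ‖∑ k ∈ Finset.Icc (-(W : ℤ)) W, (φ s j k : ℂ) * fourier k y‖]
        refine (Finset.prod_le_prod (fun j _ => integral_nonneg fun _ => norm_nonneg _)
          fun j _ => (h s hs j).2.2).trans ?_
        simp
    _ = (2 * π) ^ d * S.card := by rw [Finset.sum_const, nsmul_eq_mul, mul_comm]

theorem sum_freqBox_prod_le {d W : ℕ} {N : Fin d → ℝ} {φ : Fin d → ℤ → ℝ}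
    (h : ∀ j, IsFejerAtom W (N j) (φ j)) :
    ∑ k ∈ freqBox d W, ∏ j, φ j (k j) ≤ ∏ j, N j := by
  rw [freqBox, ← Finset.prod_univ_sum (fun _ => Finset.Icc (-(W : ℤ)) W) fun j k => φ j k]
  exact Finset.prod_le_prod (fun j _ => Finset.sum_nonneg fun k _ => (h j).1 k)
    fun j _ => (h j).2.1

theorem exists_dyadic_level (k : ℤ) : ∃ t : ℕ, (2 ^ t / 2 : ℤ) ≤ |k| ∧ |k| < 2 ^ t := by
  refine ⟨k.natAbs.size, ?_, ?_⟩
  · rcases h : k.natAbs.size with _ | t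
    · simp
    · have := Nat.lt_size.1 (h ▸ Nat.lt_succ_self t : t < k.natAbs.size)
      rw [pow_succ, Int.mul_ediv_cancel _ (by norm_num), Int.abs_eq_natAbs]
      exact_mod_cast this
  · rw [Int.abs_eq_natAbs]
    exact_mod_cast Nat.lt_size_self _

theorem dyadic_level_le {a : ℤ} {t u : ℕ} (h1 : (2 ^ t / 2 : ℤ) ≤ a) (h2 : a < 2 ^ u) : t ≤ u := by
  rcases t with _ | t
  · exact Nat.zero_le _
  · rw [pow_succ, Int.mul_ediv_cancel _ (by norm_num)] at h1
    exact (pow_lt_pow_iff_right₀ (by norm_num : (1 : ℤ) < 2)).1 (h1.trans_lt h2)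

/-- The indicator of a dyadic ball for the distinguished coordinate `i`, and of a dyadic block for
the other coordinates. -/
def dyadicInd {d : ℕ} (i j : Fin d) (t : ℕ) (k : ℤ) : ℝ :=
  if j = i then if |k| < 2 ^ t then 1 else 0
  else if (2 ^ t / 2 : ℤ) ≤ |k| ∧ |k| < 2 ^ t then 1 else 0

theorem atomicDecomp_dyadicInd {d n t : ℕ} (ht : t ≤ n) (i j : Fin d) :
    AtomicDecomp n t 8 (dyadicInd i j t) := by
  unfold dyadicInd
  by_cases h : j = i
  · simpa [h] using atomicDecomp_ball ht
  · simpa [h] using atomicDecomp_block ht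

theorem le_of_mem_piAntidiag {d n : ℕ} {s : Fin d → ℕ}
    (hs : s ∈ Finset.piAntidiag Finset.univ n) (j : Fin d) : s j ≤ n := by
  rw [← (Finset.mem_piAntidiag.1 hs).1]
  exact Finset.single_le_sum (fun _ _ => Nat.zero_le _) (Finset.mem_univ j)

theorem eq_of_mem_piAntidiag {d n : ℕ} (i : Fin d) {s t : Fin d → ℕ}
    (hs : s ∈ Finset.piAntidiag Finset.univ n) (ht : t ∈ Finset.piAntidiag Finset.univ n)
    (h : ∀ j ≠ i, s j = t j) : s = t := by
  have h1 := (Finset.mem_piAntidiag.1 hs).1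
  have h2 := (Finset.mem_piAntidiag.1 ht).1
  rw [← Finset.add_sum_erase _ _ (Finset.mem_univ i)] at h1 h2
  have h3 : ∑ j ∈ Finset.univ.erase i, s j = ∑ j ∈ Finset.univ.erase i, t j :=
    Finset.sum_congr rfl fun j hj => h j (Finset.ne_of_mem_erase hj)
  funext j
  by_cases hj : j = i
  · subst hj
    change s j + ∑ x ∈ Finset.univ.erase j, s x = n at h1
    change t j + ∑ x ∈ Finset.univ.erase j, t x = n at h2
    omega
  · exact h j hj

theorem card_piAntidiag_le {d : ℕ} (hd : 1 ≤ d) (n : ℕ) :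
    (Finset.piAntidiag (Finset.univ : Finset (Fin d)) n).card ≤ (n + 1) ^ (d - 1) := by
  let i : Fin d := ⟨0, hd⟩
  calc _ ≤ (Fintype.piFinset fun _ : {j : Fin d // j ≠ i} => Finset.range (n + 1)).card := by
        refine Finset.card_le_card_of_injOn (fun s j => s j) (fun s hs => ?_) fun s hs t ht h => ?_
        · rw [Finset.mem_coe, Fintype.mem_piFinset]
          exact fun j => Finset.mem_range_succ_iff.2 (le_of_mem_piAntidiag hs j)
        · exact eq_of_mem_piAntidiag i hs ht fun j hj => congrFun h ⟨j, hj⟩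
    _ = (n + 1) ^ (d - 1) := by simp [Fintype.card_subtype_compl]

theorem indicator_hypCross {d n : ℕ} (i : Fin d) (k : Fin d → ℤ) :
    (if k ∈ hypCross d n then (1 : ℝ) else 0) =
      ∑ s ∈ Finset.piAntidiag Finset.univ n, ∏ j, dyadicInd i j (s j) (k j) := by
  have hprod : ∀ s : Fin d → ℕ, ∏ j, dyadicInd i j (s j) (k j) =
      if ∀ j, |k j| < 2 ^ s j ∧ (j ≠ i → (2 ^ s j / 2 : ℤ) ≤ |k j|) then 1 else 0 := fun s => by
    have h := Fintype.prod_boole (M₀ := ℝ)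
      (p := fun j => |k j| < 2 ^ s j ∧ (j ≠ i → (2 ^ s j / 2 : ℤ) ≤ |k j|))
    refine Eq.trans (Finset.prod_congr rfl fun j _ => ?_) (h.trans (by congr))
    by_cases hj : j = i <;> simp [dyadicInd, hj, and_comm]
  have hex : k ∈ hypCross d n ↔ ∃ s ∈ Finset.piAntidiag (Finset.univ : Finset (Fin d)) n,
      ∀ j, |k j| < 2 ^ s j ∧ (j ≠ i → (2 ^ s j / 2 : ℤ) ≤ |k j|) := by
    rw [hypCross, Finset.mem_filter]
    constructor
    · rintro ⟨-, s, hs, hk⟩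
      refine ⟨Function.update s i (s i + (n - ∑ j, s j)), ?_, fun j => ?_⟩
      · rw [Finset.mem_piAntidiag]
        refine ⟨?_, fun j _ => Finset.mem_univ j⟩
        rw [← Finset.add_sum_erase _ _ (Finset.mem_univ i)] at hs ⊢
        rw [Finset.sum_congr rfl fun j hj =>
          Function.update_of_ne (Finset.ne_of_mem_erase hj) _ _, Function.update_self,
          ← Finset.add_sum_erase _ s (Finset.mem_univ i)]
        omega
      · by_cases hj : j = i
        · subst hj
          rw [Function.update_self]
          exact ⟨(hk j).2.trans_le (pow_le_pow_right₀ (by norm_num) (by omega)),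
            fun h => absurd rfl h⟩
        · rw [Function.update_of_ne hj]
          exact ⟨(hk j).2, fun _ => (hk j).1⟩
    · rintro ⟨s, hs, hk⟩
      obtain ⟨t, ht1, ht2⟩ := exists_dyadic_level (k i)
      refine ⟨?_, Function.update s i t, ?_, fun j => ?_⟩
      · rw [Finset.mem_Icc]
        have h : ∀ j, |k j| ≤ 2 ^ n := fun j =>
          (hk j).1.le.trans (pow_le_pow_right₀ (by norm_num) (le_of_mem_piAntidiag hs j))
        exact ⟨fun j => (abs_le.1 (h j)).1, fun j => (abs_le.1 (h j)).2⟩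
      · rw [← (Finset.mem_piAntidiag.1 hs).1]
        refine Finset.sum_le_sum fun j _ => ?_
        by_cases hj : j = i
        · subst hj
          rw [Function.update_self]
          exact dyadic_level_le ht1 (hk j).1
        · rw [Function.update_of_ne hj]
      · by_cases hj : j = i
        · subst hj
          rw [Function.update_self]
          exact ⟨ht1, ht2⟩
        · rw [Function.update_of_ne hj]
          exact ⟨(hk j).2 hj, (hk j).1⟩
  simp_rw [hprod]
  split_ifs with hk
  · obtain ⟨s, hs, hks⟩ := hex.1 hk
    rw [Finset.sum_eq_single_of_mem s hs, if_pos hks]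
    intro t ht hts
    refine if_neg fun hkt => hts (eq_of_mem_piAntidiag i ht hs fun j hj => ?_)
    exact le_antisymm (dyadic_level_le ((hkt j).2 hj) (hks j).1)
      (dyadic_level_le ((hks j).2 hj) (hkt j).1)
  · exact (Finset.sum_eq_zero fun s hs => if_neg fun h => hk (hex.2 ⟨s, hs, h⟩)).symm

theorem Covers.mono_exp {α X : Type*} [NormedAddCommGroup X] {P : Set α} {T : α → X}
    {b b' : ℕ} {ε : ℝ} (h : Covers P T b ε) (hb : b ≤ b') : Covers P T b' ε := by
  obtain ⟨S, hS, hT⟩ := h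
  exact ⟨S, hS.trans (Nat.pow_le_pow_right (by norm_num) hb), hT⟩

/-- The index set for products of `d` atomic decompositions. -/
def atomIndex (d n : ℕ) : Finset (Fin d → ℕ × Fin 8) :=
  Fintype.piFinset fun _ => Finset.range (n + 1) ×ˢ Finset.univ

theorem sum_atomIndex_pow_le (d n : ℕ) {θ : ℝ} (h0 : 0 ≤ θ) (h1 : θ < 1) :
    ∑ q ∈ atomIndex d n, ∏ j, θ ^ (q j).1 ≤ (8 / (1 - θ)) ^ d := by
  rw [atomIndex, ← Finset.prod_univ_sum (fun _ => Finset.range (n + 1) ×ˢ Finset.univ)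
    fun _ (r : ℕ × Fin 8) => θ ^ r.1]
  have h : ∑ r ∈ Finset.range (n + 1) ×ˢ (Finset.univ : Finset (Fin 8)), θ ^ r.1 ≤
      8 / (1 - θ) := by
    rw [Finset.sum_product]
    simp only [Finset.sum_const, Finset.card_univ, Fintype.card_fin, nsmul_eq_mul]
    rw [← Finset.mul_sum, div_eq_mul_inv, ← tsum_geometric_of_lt_one h0 h1]
    exact mul_le_mul_of_nonneg_left ((summable_geometric_of_lt_one h0 h1).sum_le_tsum _
      fun _ _ => by positivity) (by norm_num)
  refine (Finset.prod_le_prod (fun _ _ => Finset.sum_nonneg fun _ _ => by positivity)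
    fun j _ => h).trans ?_
  rw [Finset.prod_const, Finset.card_univ, Fintype.card_fin]

theorem exists_hypCross_decomp {d n : ℕ} (hd : 1 ≤ d) :
    ∃ M : (Fin d → ℕ × Fin 8) → (Fin d → ℤ) → ℝ, (∀ q k, 0 ≤ M q k) ∧
      (∀ k, (if k ∈ hypCross d n then (1 : ℝ) else 0) = ∑ q ∈ atomIndex d n, M q k) ∧
      (∀ q, ∑ k ∈ freqBox d (2 ^ n), M q k ≤
        (n + 1) ^ (d - 1) * 2 ^ n * ∏ j, (1 / 2 : ℝ) ^ (q j).1) ∧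
      ∀ q, ∫ x : Torus d, ‖trigPoly (freqBox d (2 ^ n)) (fun k => (M q k : ℂ)) x‖ ≤
        (2 * π) ^ d * (n + 1) ^ (d - 1) := by
  let i : Fin d := ⟨0, hd⟩
  set S := Finset.piAntidiag (Finset.univ : Finset (Fin d)) n with hS
  have hcard : (S.card : ℝ) ≤ (n + 1) ^ (d - 1) := by exact_mod_cast card_piAntidiag_le hd n
  have hdec : ∀ j : Fin d, ∀ t : ℕ, ∃ φ : ℕ → Fin 8 → ℤ → ℝ, t ≤ n →
      (∀ r c, IsFejerAtom (2 ^ n) (2 ^ t / 2 ^ r) (φ r c)) ∧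
        ∀ k, dyadicInd i j t k = ∑ r ∈ Finset.range (n + 1), ∑ c, φ r c k := fun j t => by
    by_cases ht : t ≤ n
    · obtain ⟨φ, hφ⟩ := atomicDecomp_dyadicInd ht i j
      exact ⟨φ, fun _ => hφ⟩
    · exact ⟨fun _ _ _ => 0, fun h => absurd h ht⟩
  choose φ hφ using hdec
  have hatom : ∀ (q : Fin d → ℕ × Fin 8), ∀ s ∈ S, ∀ j,
      IsFejerAtom (2 ^ n) (2 ^ s j / 2 ^ (q j).1) (φ j (s j) (q j).1 (q j).2) :=
    fun q s hs j => (hφ j (s j) (le_of_mem_piAntidiag hs j)).1 _ _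
  refine ⟨fun q k => ∑ s ∈ S, ∏ j, φ j (s j) (q j).1 (q j).2 (k j), fun q k => ?_, fun k => ?_,
    fun q => ?_, fun q => ?_⟩
  · exact Finset.sum_nonneg fun s hs => Finset.prod_nonneg fun j _ => (hatom q s hs j).1 _
  · rw [indicator_hypCross i k, Finset.sum_comm]
    refine Finset.sum_congr rfl fun s hs => ?_
    rw [atomIndex, ← Finset.prod_univ_sum (fun _ => Finset.range (n + 1) ×ˢ Finset.univ)
      fun j (r : ℕ × Fin 8) => φ j (s j) r.1 r.2 (k j)]
    refine Finset.prod_congr rfl fun j _ => ?_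
    rw [(hφ j (s j) (le_of_mem_piAntidiag hs j)).2, Finset.sum_product]
  · rw [Finset.sum_comm]
    have h : ∀ s ∈ S, ∑ k ∈ freqBox d (2 ^ n), ∏ j, φ j (s j) (q j).1 (q j).2 (k j) ≤
        2 ^ n * ∏ j, (1 / 2 : ℝ) ^ (q j).1 := fun s hs => by
      refine (sum_freqBox_prod_le (hatom q s hs)).trans (le_of_eq ?_)
      simp only [div_eq_mul_inv, one_mul, inv_pow]
      rw [Finset.prod_mul_distrib, Finset.prod_pow_eq_pow_sum, (Finset.mem_piAntidiag.1 hs).1]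
    refine (Finset.sum_le_sum h).trans ?_
    rw [Finset.sum_const, nsmul_eq_mul, mul_assoc]
    exact mul_le_mul_of_nonneg_right hcard (by positivity)
  · refine (integral_norm_trigPoly_le_card S (hatom q)).trans ?_
    exact mul_le_mul_of_nonneg_left hcard (by positivity)

/-- The constant in `covers_hypCross`. -/
def hypCrossConst (d : ℕ) (p : ℝ) : ℝ :=
  (sudakovConst d + 1) * (2 * 32 ^ d) ^ (1 / p) * (8 / (1 - (2 / 3 : ℝ) ^ (1 / p))) ^ d

theorem hypCrossConst_pos (d : ℕ) {p : ℝ} (hp : 0 < p) : 0 < hypCrossConst d p := by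
  have h : (2 / 3 : ℝ) ^ (1 / p) < 1 := rpow_lt_one (by norm_num) (by norm_num) (by positivity)
  have h' : 0 < 1 - (2 / 3 : ℝ) ^ (1 / p) := by linarith
  unfold hypCrossConst sudakovConst
  positivity

theorem covers_hypCross {d n : ℕ} (hd : 1 ≤ d) (hn : 1 ≤ n) {p : ℝ} (hp : 2 ≤ p) (b : ℕ) :
    Covers {f : Lp ℂ (ENNReal.ofReal p) (volume : Measure (Torus d)) | ‖f‖ ≤ 1}
      (fun f => trigPoly (hypCross d n) fun k => fCoeff f k) b
      (hypCrossConst d p * (((n + 1 : ℝ) ^ (d - 1)) ^ (1 - 1 / p) *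
        (n * 2 ^ n / (b + 1)) ^ (1 / p))) := by
  obtain ⟨M, hM0, hMsum, hMN, hMK⟩ := exists_hypCross_decomp (n := n) hd
  have hp0 : 0 < p := by linarith
  have hn0 : (0 : ℝ) < n := by exact_mod_cast hn
  set Q := atomIndex d n with hQ
  set A : ℝ := (n + 1) ^ (d - 1) with hA
  have hA0 : 0 < A := by positivity
  set w : (Fin d → ℕ × Fin 8) → ℝ := fun q => (32 ^ d)⁻¹ * ∏ j, (3 / 4 : ℝ) ^ (q j).1 with hw
  have hw0 : ∀ q, 0 < w q := fun q => by positivity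
  have hwsum : ∑ q ∈ Q, w q ≤ 1 := by
    have h := sum_atomIndex_pow_le d n (θ := 3 / 4) (by norm_num) (by norm_num)
    rw [← Finset.mul_sum, inv_mul_le_iff₀ (by positivity), mul_one]
    exact h.trans (le_of_eq (by norm_num))
  have hw1 : ∀ q, w q ≤ 1 := fun q => by
    have h1 : ∏ j, (3 / 4 : ℝ) ^ (q j).1 ≤ 1 :=
      Finset.prod_le_one (fun _ _ => by positivity) fun _ _ =>
        pow_le_one₀ (by norm_num) (by norm_num)
    have h2 : ((32 : ℝ) ^ d)⁻¹ ≤ 1 := inv_le_one_of_one_le₀ (one_le_pow₀ (by norm_num))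
    exact mul_le_one₀ h2 (by positivity) h1
  set β : (Fin d → ℕ × Fin 8) → ℕ := fun q => ⌊b * w q⌋₊ with hβ
  have hβsum : ∑ q ∈ Q, β q ≤ b := by
    have h : (∑ q ∈ Q, β q : ℝ) ≤ b := by
      calc (∑ q ∈ Q, β q : ℝ) ≤ ∑ q ∈ Q, b * w q :=
            Finset.sum_le_sum fun q _ => Nat.floor_le (by have := hw0 q; positivity)
        _ ≤ b := by
            rw [← Finset.mul_sum]
            exact mul_le_of_le_one_right (by positivity) hwsum
    exact_mod_cast h
  have hβ1 : ∀ q, (b + 1) * w q / 2 ≤ (β q : ℝ) + 1 := fun q => by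
    have h1 := (Nat.lt_floor_add_one ((b : ℝ) * w q)).le
    have h2 := hw1 q
    have h3 : (0 : ℝ) ≤ β q := by positivity
    change (b : ℝ) * w q ≤ β q + 1 at h1
    linarith
  set θ : ℝ := (2 / 3 : ℝ) ^ (1 / p) with hθ
  have hθ0 : 0 ≤ θ := by positivity
  have hθ1 : θ < 1 := rpow_lt_one (by norm_num) (by norm_num) (by positivity)
  have hM1 : ∀ q ∈ Q, ∀ k, M q k ≤ 1 := fun q hq k => by
    refine (Finset.single_le_sum (fun q _ => hM0 q k) hq).trans ?_
    rw [← hMsum]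
    split_ifs <;> norm_num
  set Z : ℝ := n * 2 ^ n / (b + 1) with hZ
  have hZ0 : 0 < Z := by positivity
  have hcov : ∀ q ∈ Q, Covers {f : Lp ℂ (ENNReal.ofReal p) (volume : Measure (Torus d)) | ‖f‖ ≤ 1}
      (fun f => trigPoly (freqBox d (2 ^ n)) fun k => M q k * fCoeff f k) (β q)
      ((sudakovConst d + 1) * (2 * 32 ^ d) ^ (1 / p) * (A ^ (1 - 1 / p) * Z ^ (1 / p)) *
        ∏ j, θ ^ (q j).1) := fun q hq => by
    have hr : 0 < ∏ j, (1 / 2 : ℝ) ^ (q j).1 := Finset.prod_pos fun _ _ => by positivity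
    refine (covers_multiplier_Lp hn hp (M q) (hM0 q) (hM1 q hq) (N := A * 2 ^ n * _)
      (mul_pos (by positivity) hr) (hMN q) hA0 (hMK q) (β q)).mono_radius ?_
    have h1 : n * (A * 2 ^ n * ∏ j, (1 / 2 : ℝ) ^ (q j).1) / (β q + 1) ≤
        2 * 32 ^ d * A * Z * ∏ j, (2 / 3 : ℝ) ^ (q j).1 := by
      refine (div_le_div_of_nonneg_left (by positivity) (by have := hw0 q; positivity)
        (hβ1 q)).trans (le_of_eq ?_)
      have h2 : ∏ j, (1 / 2 : ℝ) ^ (q j).1 =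
          (∏ j, (2 / 3 : ℝ) ^ (q j).1) * ∏ j, (3 / 4 : ℝ) ^ (q j).1 := by
        rw [← Finset.prod_mul_distrib]
        refine Finset.prod_congr rfl fun j _ => ?_
        rw [← mul_pow]
        norm_num
      have h3 : (∏ j, (3 / 4 : ℝ) ^ (q j).1) ≠ 0 := Finset.prod_ne_zero_iff.2 fun _ _ => by positivity
      rw [h2, hZ, hw]
      field_simp
    have h4 : (∏ j, (2 / 3 : ℝ) ^ (q j).1) ^ (1 / p) = ∏ j, θ ^ (q j).1 := by
      rw [← finsetProd_rpow _ _ fun _ _ => by positivity]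
      refine Finset.prod_congr rfl fun j _ => ?_
      rw [hθ, ← rpow_natCast, ← rpow_natCast, ← rpow_mul (by norm_num), ← rpow_mul (by norm_num),
        mul_comm]
    have h5 : A ^ (1 - 2 / p) * A ^ (1 / p) = A ^ (1 - 1 / p) := by
      rw [← rpow_add hA0]
      congr 1
      ring
    have hs : 0 ≤ sudakovConst d + 1 := by unfold sudakovConst; positivity
    calc _ ≤ (sudakovConst d + 1) * (A ^ (1 - 2 / p) *
          (2 * 32 ^ d * A * Z * ∏ j, (2 / 3 : ℝ) ^ (q j).1) ^ (1 / p)) := by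
          refine mul_le_mul_of_nonneg_left (mul_le_mul_of_nonneg_left
            (rpow_le_rpow (by positivity) h1 (by positivity)) (by positivity)) hs
      _ = _ := by
          rw [mul_rpow (by positivity) (Finset.prod_nonneg fun _ _ => by positivity), h4,
            mul_rpow (by positivity) hZ0.le, mul_rpow (by positivity) hA0.le, ← h5]
          ring
  have hfinal := ((Covers.sum Q hcov).mono_exp hβsum).mono_radius (ε' := hypCrossConst d p *
    (A ^ (1 - 1 / p) * Z ^ (1 / p))) ?_
  · convert hfinal using 2 with f
    ext x
    simp only [ContinuousMap.sum_apply, trigPoly_apply]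
    rw [Finset.sum_comm]
    simp_rw [← Finset.sum_mul, ← Complex.ofReal_sum, ← hMsum]
    refine (Finset.sum_subset_zero_on_sdiff (fun k hk => ?_) (fun k hk => ?_) fun k hk => ?_)
    · rw [hypCross, Finset.mem_filter, Finset.mem_Icc] at hk
      rw [mem_freqBox]
      intro j
      push_cast
      exact abs_le.2 ⟨hk.1.1 j, hk.1.2 j⟩
    · rw [if_neg (Finset.mem_sdiff.1 hk).2]
      simp
    · rw [if_pos hk]
      simp
  · rw [← Finset.mul_sum]
    have h := sum_atomIndex_pow_le d n hθ0 hθ1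
    have hs : 0 ≤ sudakovConst d + 1 := by unfold sudakovConst; positivity
    calc _ ≤ (sudakovConst d + 1) * (2 * 32 ^ d) ^ (1 / p) * (A ^ (1 - 1 / p) * Z ^ (1 / p)) *
          (8 / (1 - θ)) ^ d := mul_le_mul_of_nonneg_left h (by positivity)
      _ = _ := by
          rw [hypCrossConst]
          ring

theorem toLinfty_sub {d : ℕ} (g h : C(Torus d, ℂ)) :
    toLinfty (g - h) = toLinfty g - toLinfty h :=
  map_sub (ContinuousMap.toLp ∞ (volume : Measure (Torus d)) ℂ) g h

theorem norm_toLinfty_le {d : ℕ} (g : C(Torus d, ℂ)) : ‖toLinfty g‖ ≤ ‖g‖ := by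
  have h := ContinuousLinearMap.le_of_opNorm_le _
    (ContinuousMap.toLp_norm_le (p := ∞) (volume : Measure (Torus d)) (𝕜 := ℂ) (E := ℂ)) g
  simpa [toLinfty] using h

theorem eN_le_of_covers {d : ℕ} {q : ℝ≥0∞} {E : Finset (Fin d → ℤ)} {m : ℕ} {ε : ℝ} (hε : 0 < ε)
    (h : Covers {f : Lp ℂ q (volume : Measure (Torus d)) | ‖f‖ ≤ 1}
      (fun f => trigPoly E fun k => fCoeff f k) (m - 1) ε) :
    eN (SE d q E) m ≤ ε := by
  obtain ⟨S, hS, hT⟩ := h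
  refine csInf_le ⟨0, fun _ h => h.1.le⟩ ⟨hε, S.image toLinfty, Finset.card_image_le.trans hS,
    fun f hf => ?_⟩
  obtain ⟨y, hy, hyε⟩ := hT f hf
  refine ⟨toLinfty y, Finset.mem_image_of_mem _ hy, ?_⟩
  rw [SE, ← toLinfty_sub]
  exact (norm_toLinfty_le _).trans hyε

theorem stmt13 (d : ℕ) (hd : 1 ≤ d) (p : ℝ) (hp : 2 ≤ p) :
    ∃ C : ℝ, 0 < C ∧ ∀ n : ℕ, 1 ≤ n → ∀ m : ℕ, 1 ≤ m → m ≤ (hypCross d n).card →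
      eN (SE d (ENNReal.ofReal p) (hypCross d n)) m ≤
        C * ((2 ^ n : ℝ) / m) ^ (1 / p) *
          (n : ℝ) ^ ((d - 1 : ℝ) * (1 - 1 / p) + 1 / p) := by
  have hp0 : 0 < p := by linarith
  have hC := hypCrossConst_pos d hp0
  refine ⟨hypCrossConst d p * (2 ^ (d - 1)) ^ (1 - 1 / p), by positivity, fun n hn m hm _ => ?_⟩
  have hn0 : (0 : ℝ) < n := by exact_mod_cast hn
  have hn1 : (1 : ℝ) ≤ n := by exact_mod_cast hn
  have hm0 : (0 : ℝ) < m := by exact_mod_cast hm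
  have hmb : ((m - 1 : ℕ) : ℝ) + 1 = m := by
    rw [Nat.cast_sub hm]
    push_cast
    ring
  have h := covers_hypCross hd hn hp (m - 1)
  rw [hmb] at h
  refine (eN_le_of_covers (by positivity) h).trans ?_
  have he : 0 ≤ 1 - 1 / p := by
    rw [sub_nonneg, div_le_one hp0]
    linarith
  have hdc : ((d - 1 : ℕ) : ℝ) = d - 1 := by
    rw [Nat.cast_sub hd, Nat.cast_one]
  have h1 : ((n + 1 : ℝ) ^ (d - 1)) ^ (1 - 1 / p) ≤
      (2 ^ (d - 1)) ^ (1 - 1 / p) * (n : ℝ) ^ ((d - 1 : ℝ) * (1 - 1 / p)) := by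
    have h2 : (n + 1 : ℝ) ^ (d - 1) ≤ 2 ^ (d - 1) * n ^ (d - 1) := by
      rw [← mul_pow]
      exact pow_le_pow_left₀ (by positivity) (by linarith) _
    refine (rpow_le_rpow (by positivity) h2 he).trans (le_of_eq ?_)
    rw [mul_rpow (by positivity) (by positivity), ← rpow_natCast (n : ℝ) (d - 1),
      ← rpow_mul hn0.le, hdc]
  have h3 : (n * 2 ^ n / m : ℝ) ^ (1 / p) = ((2 ^ n : ℝ) / m) ^ (1 / p) * (n : ℝ) ^ (1 / p) := by
    rw [mul_div_assoc, mul_rpow hn0.le (by positivity), mul_comm]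
  rw [h3, rpow_add hn0]
  calc _ ≤ hypCrossConst d p * ((2 ^ (d - 1)) ^ (1 - 1 / p) *
        (n : ℝ) ^ ((d - 1 : ℝ) * (1 - 1 / p)) *
        (((2 ^ n : ℝ) / m) ^ (1 / p) * (n : ℝ) ^ (1 / p))) := by gcongr
    _ = _ := by ring

end
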